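/- Let X be a GC_5 set of 21 nodes with no maximal line. Then no node of X has m-distribution sequence (4,4,4,4,4). -/

import Mathlib

open MvPolynomial

/-- Evaluation of a bivariate polynomial at a point of the real plane. -/
noncomputable def ev (p : MvPolynomial (Fin 2) ℝ) (A : ℝ × ℝ) : ℝ :=
  MvPolynomial.eval ![A.1, A.2] p

/-- A polynomial of total degree exactly 1, defining a line. -/
def IsLinePoly (l : MvPolynomial (Fin 2) ℝ) : Prop := l.totalDegree = 1

/-- The line (zero set) defined by a polynomial. -/
def lineSet (l : MvPolynomial (Fin 2) ℝ) : Set (ℝ × ℝ) := {A | ev l A = 0}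

/-- The number of nodes of `X` lying on the line defined by `l`. -/
noncomputable def nodesOn (X : Set (ℝ × ℝ)) (l : MvPolynomial (Fin 2) ℝ) : ℕ :=
  (X ∩ lineSet l).ncard

/-- `X` is an `n`-poised set: it has `N = (n+2)(n+1)/2` nodes and the only polynomial of
degree ≤ n vanishing on all of `X` is the zero polynomial. -/
def Poised (n : ℕ) (X : Set (ℝ × ℝ)) : Prop :=
  X.Finite ∧ X.ncard = (n + 2) * (n + 1) / 2 ∧
    ∀ p : MvPolynomial (Fin 2) ℝ, p.totalDegree ≤ n → (∀ A ∈ X, ev p A = 0) → p = 0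

/-- `p` is an `n`-fundamental polynomial of the node `A` with respect to `X`. -/
def IsFund (n : ℕ) (X : Set (ℝ × ℝ)) (A : ℝ × ℝ) (p : MvPolynomial (Fin 2) ℝ) : Prop :=
  p.totalDegree ≤ n ∧ ev p A = 1 ∧ ∀ B ∈ X, B ≠ A → ev p B = 0

/-- `X` is a `GC_n` set: it is `n`-poised and each fundamental polynomial is a product of
`n` linear (degree-1) polynomials. -/
def GCSet (n : ℕ) (X : Set (ℝ × ℝ)) : Prop :=
  Poised n X ∧ ∀ A ∈ X, ∃ p : MvPolynomial (Fin 2) ℝ, IsFund n X A p ∧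
    ∃ f : Fin n → MvPolynomial (Fin 2) ℝ, (∀ i, IsLinePoly (f i)) ∧ p = ∏ i, f i

/-- The node `A` uses the line `l`: the linear polynomial `l` divides a fundamental
polynomial of `A`. -/
def Uses (n : ℕ) (X : Set (ℝ × ℝ)) (A : ℝ × ℝ) (l : MvPolynomial (Fin 2) ℝ) : Prop :=
  ∃ p, IsFund n X A p ∧ l ∣ p

/-- `X` has no maximal line, i.e. no line passes through `n+1` nodes of `X`. -/
def NoMaximalLine (n : ℕ) (X : Set (ℝ × ℝ)) : Prop :=
  ∀ l : MvPolynomial (Fin 2) ℝ, IsLinePoly l → nodesOn X l ≠ n + 1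

/-- Number of nodes of `X` on the line `l` which do not lie on any of the lines
`L 0, …, L (s-1)` (the primary node count of `l` at step `s`). -/
noncomputable def resCount (X : Set (ℝ × ℝ)) (L : Fin 5 → MvPolynomial (Fin 2) ℝ)
    (s : Fin 5) (l : MvPolynomial (Fin 2) ℝ) : ℕ :=
  {B ∈ X | ev l B = 0 ∧ ∀ i : Fin 5, i < s → ev (L i) B ≠ 0}.ncard

/-- `L` is an m-line sequence of the node `A` of the `GC_5` set `X`: it enumerates the five
distinct used lines of `A` (a fundamental polynomial of `A` is, up to a constant, the
product of the `L i`), ordered greedily: at each step `s` the line `L s` has maximal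
primary node count among the remaining used lines. -/
def MLineSeq (X : Set (ℝ × ℝ)) (A : ℝ × ℝ) (L : Fin 5 → MvPolynomial (Fin 2) ℝ) : Prop :=
  (∀ i, IsLinePoly (L i)) ∧
  (∀ i j : Fin 5, i ≠ j → lineSet (L i) ≠ lineSet (L j)) ∧
  (∃ p : MvPolynomial (Fin 2) ℝ, IsFund 5 X A p ∧ ∃ c : ℝ, p = MvPolynomial.C c * ∏ i, L i) ∧
  (∀ s t : Fin 5, s ≤ t → resCount X L s (L t) ≤ resCount X L s (L s))

/-- The node `A` has m-distribution sequence `k`. -/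
def HasMDSeq (X : Set (ℝ × ℝ)) (A : ℝ × ℝ) (k : Fin 5 → ℕ) : Prop :=
  ∃ L : Fin 5 → MvPolynomial (Fin 2) ℝ, MLineSeq X A L ∧ ∀ s, resCount X L s (L s) = k s

section PlanePolynomials

lemma ev_add (p q : MvPolynomial (Fin 2) ℝ) (P : ℝ × ℝ) : ev (p + q) P = ev p P + ev q P := by
  simp [ev]

lemma ev_sub (p q : MvPolynomial (Fin 2) ℝ) (P : ℝ × ℝ) : ev (p - q) P = ev p P - ev q P := by
  simp [ev]

lemma ev_mul (p q : MvPolynomial (Fin 2) ℝ) (P : ℝ × ℝ) : ev (p * q) P = ev p P * ev q P := by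
  simp [ev]

lemma ev_C (c : ℝ) (P : ℝ × ℝ) : ev (C c) P = c := by simp [ev]

lemma ev_zero (P : ℝ × ℝ) : ev 0 P = 0 := by simp [ev]

lemma ev_X_zero (P : ℝ × ℝ) : ev (X 0) P = P.1 := by simp [ev]

lemma ev_X_one (P : ℝ × ℝ) : ev (X 1) P = P.2 := by simp [ev]

lemma ev_prod {ι : Type*} (s : Finset ι) (f : ι → MvPolynomial (Fin 2) ℝ) (P : ℝ × ℝ) :
    ev (∏ i ∈ s, f i) P = ∏ i ∈ s, ev (f i) P := by
  simp [ev, map_prod]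

lemma ev_sum {ι : Type*} (s : Finset ι) (f : ι → MvPolynomial (Fin 2) ℝ) (P : ℝ × ℝ) :
    ev (∑ i ∈ s, f i) P = ∑ i ∈ s, ev (f i) P := by
  simp [ev, map_sum]

lemma IsLinePoly.exists_coeffs {l : MvPolynomial (Fin 2) ℝ} (hl : IsLinePoly l) :
    ∃ a b c : ℝ, a ^ 2 + b ^ 2 ≠ 0 ∧ l = C a * X 0 + C b * X 1 + C c := by
  have key : l = C (coeff (Finsupp.single 0 1) l) * X 0 + C (coeff (Finsupp.single 1 1) l) * X 1
      + C (coeff 0 l) := by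
    ext m
    simp only [coeff_add, coeff_C_mul, coeff_X, coeff_C]
    by_cases h0 : m = 0
    · subst h0; simp
    by_cases h1 : m = Finsupp.single 0 1
    · subst h1
      simpa [Finsupp.single_left_inj] using fun h => absurd h.symm h0
    by_cases h2 : m = Finsupp.single 1 1
    · subst h2
      simpa [Finsupp.single_left_inj] using fun h => absurd h.symm h0
    rw [if_neg (fun h => h1 h.symm), if_neg (fun h => h2 h.symm), if_neg (fun h => h0 h.symm)]
    simp only [mul_zero, add_zero]
    apply coeff_eq_zero_of_totalDegree_lt
    rw [hl]
    have hs : ∑ i ∈ m.support, m i = m 0 + m 1 := by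
      simpa [Finsupp.sum] using Finsupp.sum_fintype m (fun _ e => e) (by simp)
    by_contra hlt
    have hlt' : m 0 + m 1 ≤ 1 := by
      rw [← hs]; exact not_lt.mp hlt
    have : (m 0 = 0 ∧ m 1 = 0) ∨ (m 0 = 1 ∧ m 1 = 0) ∨ (m 0 = 0 ∧ m 1 = 1) := by omega
    rcases this with ⟨h, h'⟩ | ⟨h, h'⟩ | ⟨h, h'⟩
    · exact h0 (by ext i; fin_cases i <;> simp [h, h'])
    · exact h1 (by ext i; fin_cases i <;> simp [h, h'])
    · exact h2 (by ext i; fin_cases i <;> simp [h, h'])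
  refine ⟨_, _, _, ?_, key⟩
  intro h0
  have ha : coeff (Finsupp.single 0 1) l = 0 := by
    nlinarith [sq_nonneg (coeff (Finsupp.single 0 1) l), sq_nonneg (coeff (Finsupp.single 1 1) l)]
  have hb : coeff (Finsupp.single 1 1) l = 0 := by
    nlinarith [sq_nonneg (coeff (Finsupp.single 0 1) l), sq_nonneg (coeff (Finsupp.single 1 1) l)]
  rw [ha, hb] at key
  have : l.totalDegree = 0 := by
    rw [key]; simp
  rw [IsLinePoly] at hl
  omega

lemma isLinePoly_of_coeffs {a b : ℝ} (c : ℝ) (h : a ≠ 0 ∨ b ≠ 0) :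
    IsLinePoly (C a * X 0 + C b * X 1 + C c) := by
  apply le_antisymm
  · refine (totalDegree_add _ _).trans (max_le ((totalDegree_add _ _).trans (max_le ?_ ?_)) ?_)
    · exact (totalDegree_mul _ _).trans (by simp)
    · exact (totalDegree_mul _ _).trans (by simp)
    · simp
  · have zne : ∀ i : Fin 2, (0 : Fin 2 →₀ ℕ) ≠ Finsupp.single i 1 := fun i h => by
      simpa using DFunLike.congr_fun h i
    rcases h with h | h
    · have := le_totalDegree (p := (C a * X 0 + C b * X 1 + C c : MvPolynomial (Fin 2) ℝ))
        (s := Finsupp.single 0 1) (by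
        rw [mem_support_iff]
        simp [coeff_X, coeff_C, Finsupp.single_left_inj, zne, h])
      simpa using this
    · have := le_totalDegree (p := (C a * X 0 + C b * X 1 + C c : MvPolynomial (Fin 2) ℝ))
        (s := Finsupp.single 1 1) (by
        rw [mem_support_iff]
        simp [coeff_X, coeff_C, Finsupp.single_left_inj, zne, h])
      simpa using this

lemma IsLinePoly.exists_eq_mul {l p : MvPolynomial (Fin 2) ℝ} (hl : IsLinePoly l) {n : ℕ}
    (hp : p.totalDegree ≤ n) {S : Finset (ℝ × ℝ)} (hS : ∀ P ∈ S, ev l P = 0 ∧ ev p P = 0)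
    (hc : n < S.card) : ∃ q, q.totalDegree ≤ n - 1 ∧ p = l * q := by
  obtain ⟨a, b, c, hN, rfl⟩ := hl.exists_coeffs
  set N := a ^ 2 + b ^ 2 with hNdef
  let F : Fin 2 → Polynomial ℝ :=
    ![Polynomial.C (b / N) * Polynomial.X + Polynomial.C (-(a * c) / N),
      Polynomial.C (-a / N) * Polynomial.X + Polynomial.C (-(b * c) / N)]
  set u : Polynomial ℝ := aeval F p with hu
  set l : MvPolynomial (Fin 2) ℝ := C a * X 0 + C b * X 1 + C c with hldef
  have hdeg : u.natDegree ≤ n := by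
    refine (MvPolynomial.aeval_natDegree_le p hp F (n := 1) ?_).trans (by simp)
    intro i
    fin_cases i <;> exact Polynomial.natDegree_linear_le
  have heval : ∀ P : ℝ × ℝ, ev l P = 0 → u.eval (b * P.1 - a * P.2) = ev p P := by
    intro P hP
    have h1 : a * P.1 + b * P.2 + c = 0 := by
      simpa [hldef, ev_add, ev_mul, ev_C, ev_X_zero, ev_X_one] using hP
    have h2 : u.eval (b * P.1 - a * P.2)
        = aeval (fun i => (F i).eval (b * P.1 - a * P.2)) p := by
      have := MvPolynomial.comp_aeval_apply (R := ℝ) (f := F)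
        (φ := Polynomial.aeval (R := ℝ) (b * P.1 - a * P.2)) p
      simpa [Polynomial.coe_aeval_eq_eval] using this
    rw [h2, ev, ← MvPolynomial.coe_aeval_eq_eval]
    have h3 : (fun i => (F i).eval (b * P.1 - a * P.2)) = ![P.1, P.2] := by
      funext i
      fin_cases i
      · simp only [F, Fin.zero_eta, Matrix.cons_val_zero, Polynomial.eval_add, Polynomial.eval_mul,
          Polynomial.eval_C, Polynomial.eval_X]
        field_simp
        linear_combination (-a) * h1 + P.1 * hNdef
      · simp only [F, Fin.mk_one, Matrix.cons_val_one, Polynomial.eval_add,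
          Polynomial.eval_mul, Polynomial.eval_C, Polynomial.eval_X, Matrix.cons_val_fin_one]
        field_simp
        linear_combination (-b) * h1 + P.2 * hNdef
    rw [h3]
    rfl
  have hu0 : u = 0 := by
    have hinj : Set.InjOn (fun P : ℝ × ℝ => b * P.1 - a * P.2) S := by
      intro P hP Q hQ h
      have h1 := (hS P hP).1
      have h2 := (hS Q hQ).1
      simp only [hldef, ev_add, ev_mul, ev_C, ev_X_zero, ev_X_one] at h1 h2
      simp only at h
      have e1 : N * (P.1 - Q.1) = 0 := by rw [hNdef]; linear_combination b * h + a * (h1 - h2)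
      have e2 : N * (P.2 - Q.2) = 0 := by rw [hNdef]; linear_combination -a * h + b * (h1 - h2)
      exact Prod.ext (by linarith [(mul_eq_zero.mp e1).resolve_left hN])
        (by linarith [(mul_eq_zero.mp e2).resolve_left hN])
    refine Polynomial.eq_zero_of_natDegree_lt_card_of_eval_eq_zero' u
      (S.image (fun P : ℝ × ℝ => b * P.1 - a * P.2)) ?_ ?_
    · intro t ht
      obtain ⟨P, hP, rfl⟩ := Finset.mem_image.mp ht
      rw [heval P (hS P hP).1, (hS P hP).2]
    · rw [Finset.card_image_of_injOn hinj]; omega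
  have hdvd : l ∣ p := by
    rw [← Ideal.mem_span_singleton, ← Ideal.Quotient.eq_zero_iff_mem]
    let m := Ideal.Quotient.mkₐ ℝ (Ideal.span {l})
    let τ : MvPolynomial (Fin 2) ℝ := C b * X 0 - C a * X 1
    have hcomp : m = (Polynomial.aeval (m τ)).comp (aeval F) := by
      apply MvPolynomial.algHom_ext
      intro i
      have hC : ∀ x : ℝ, algebraMap ℝ (MvPolynomial (Fin 2) ℝ ⧸ Ideal.span {l}) x = m (C x) :=
        fun x => (m.commutes x).symm
      have hl0 : m l = 0 := by
        simp only [m, Ideal.Quotient.mkₐ_eq_mk]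
        exact Ideal.Quotient.eq_zero_iff_mem.mpr (Ideal.mem_span_singleton_self l)
      fin_cases i
      · simp only [AlgHom.comp_apply, aeval_X, F, Fin.zero_eta, Matrix.cons_val_zero, map_add,
          map_mul,
          Polynomial.aeval_C, Polynomial.aeval_X, hC]
        rw [← map_mul, ← map_add, ← sub_eq_zero, ← map_sub]
        have : (X 0 - (C (b / N) * τ + C (-(a * c) / N)) : MvPolynomial (Fin 2) ℝ)
            = C (a / N) * l := by
          have e1 : (1 : MvPolynomial (Fin 2) ℝ) = C (a / N) * C a + C (b / N) * C b := by
            rw [← C_mul, ← C_mul, ← C_add, ← C_1]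
            congr 1
            field_simp
            rw [hNdef]
          have e2 : (C (-(a * c) / N) : MvPolynomial (Fin 2) ℝ) = - (C (a / N) * C c) := by
            rw [← C_mul, ← C_neg]; congr 1; ring
          have e3 : (C (b / N) * C a : MvPolynomial (Fin 2) ℝ) = C (a / N) * C b := by
            rw [← C_mul, ← C_mul]; congr 1; ring
          simp only [τ, hldef]
          rw [e2]
          linear_combination X 0 * e1 + X 1 * e3
        rw [this, map_mul, hl0, mul_zero]
      · simp only [AlgHom.comp_apply, aeval_X, F, Fin.mk_one, Matrix.cons_val_one,
          Matrix.cons_val_fin_one, map_add, map_mul,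
          Polynomial.aeval_C, Polynomial.aeval_X, hC]
        rw [← map_mul, ← map_add, ← sub_eq_zero, ← map_sub]
        have : (X 1 - (C (-a / N) * τ + C (-(b * c) / N)) : MvPolynomial (Fin 2) ℝ)
            = C (b / N) * l := by
          have e1 : (1 : MvPolynomial (Fin 2) ℝ) = C (a / N) * C a + C (b / N) * C b := by
            rw [← C_mul, ← C_mul, ← C_add, ← C_1]
            congr 1
            field_simp
            rw [hNdef]
          have e2 : (C (-(b * c) / N) : MvPolynomial (Fin 2) ℝ) = - (C (b / N) * C c) := by
            rw [← C_mul, ← C_neg]; congr 1; ring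
          have e3 : (C (b / N) * C a : MvPolynomial (Fin 2) ℝ) = C (a / N) * C b := by
            rw [← C_mul, ← C_mul]; congr 1; ring
          have e4 : (C (-a / N) : MvPolynomial (Fin 2) ℝ) = - C (a / N) := by
            rw [← C_neg]; congr 1; ring
          simp only [τ, hldef]
          rw [e2, e4]
          linear_combination X 1 * e1 - X 0 * e3
        rw [this, map_mul, hl0, mul_zero]
    change m p = 0
    rw [hcomp, AlgHom.comp_apply, ← hu, hu0, map_zero]
  obtain ⟨q, hq⟩ := hdvd
  refine ⟨q, ?_, hq⟩
  by_cases hq0 : q = 0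
  · simp [hq0]
  have hl0 : l ≠ 0 := by
    rintro h
    rw [IsLinePoly, h] at hl
    simp at hl
  have := totalDegree_mul_of_isDomain hl0 hq0
  rw [← hq, hl] at this
  omega

/-- The exponents of total degree at most `n` in two variables. -/
lemma finrank_restrictTotalDegree (n : ℕ) :
    Module.finrank ℝ (restrictTotalDegree (Fin 2) ℝ n) =
      ((Finset.range (n + 1) ×ˢ Finset.range (n + 1)).filter (fun x => x.1 + x.2 ≤ n)).card := by
  rw [restrictTotalDegree, Module.finrank_eq_nat_card_basis (basisRestrictSupport ℝ _),
    ← Nat.card_eq_finsetCard]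
  refine Nat.card_congr ((Finsupp.equivFunOnFinite.trans (finTwoArrowEquiv ℕ)).subtypeEquiv ?_)
  intro m
  have hs : (m.sum fun _ e => e) = m 0 + m 1 := by
    simpa using Finsupp.sum_fintype m (fun _ e => e) (by simp)
  change (m.sum fun _ e => e) ≤ n ↔ (m 0, m 1) ∈ _
  simp only [hs, Finset.mem_filter, Finset.mem_product, Finset.mem_range]
  omega

/-- The values at finitely many points, as a linear map on polynomials of degree at most `n`. -/
noncomputable def evalOn (n : ℕ) (S : Finset (ℝ × ℝ)) :
    restrictTotalDegree (Fin 2) ℝ n →ₗ[ℝ] (S → ℝ) where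
  toFun p P := ev p.1 P.1
  map_add' p q := by ext P; simp [ev_add]
  map_smul' c p := by ext P; simp [ev]

lemma exists_vanishing {n : ℕ} (S : Finset (ℝ × ℝ))
    (h : S.card < ((Finset.range (n + 1) ×ˢ Finset.range (n + 1)).filter
      (fun x => x.1 + x.2 ≤ n)).card) :
    ∃ p : MvPolynomial (Fin 2) ℝ, p ≠ 0 ∧ p.totalDegree ≤ n ∧ ∀ P ∈ S, ev p P = 0 := by
  rw [← finrank_restrictTotalDegree] at h
  have h2 : Module.finrank ℝ (S → ℝ) < Module.finrank ℝ (restrictTotalDegree (Fin 2) ℝ n) := by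
    simpa using h
  obtain ⟨p, hp, hp0⟩ := Submodule.exists_mem_ne_zero_of_ne_bot
    (LinearMap.ker_ne_bot_of_finrank_lt (f := evalOn n S) h2)
  refine ⟨p.1, fun h => hp0 (Subtype.ext h), (mem_restrictTotalDegree _ _ _).mp p.2, ?_⟩
  intro P hP
  exact congr_fun (LinearMap.mem_ker.mp hp) ⟨P, hP⟩

/-- The points of `S` impose independent conditions on polynomials of degree at most `n`. -/
def Indep (n : ℕ) (S : Finset (ℝ × ℝ)) : Prop :=
  ∀ v : ℝ × ℝ → ℝ, ∃ q : MvPolynomial (Fin 2) ℝ, q.totalDegree ≤ n ∧ ∀ P ∈ S, ev q P = v P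

lemma Indep.card_le {n : ℕ} {S : Finset (ℝ × ℝ)} (h : Indep n S) :
    S.card ≤ ((Finset.range (n + 1) ×ˢ Finset.range (n + 1)).filter
      (fun x => x.1 + x.2 ≤ n)).card := by
  classical
  rw [← finrank_restrictTotalDegree]
  have hs : Function.Surjective (evalOn n S) := by
    intro v
    obtain ⟨q, hq, hv⟩ := h (fun P => if hP : P ∈ S then v ⟨P, hP⟩ else 0)
    refine ⟨⟨q, (mem_restrictTotalDegree _ _ _).mpr hq⟩, ?_⟩
    ext P
    simpa [evalOn] using hv P.1 P.2
  simpa using LinearMap.finrank_le_finrank_of_surjective hs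

lemma indep_of_card_le {n : ℕ} {R : Finset (ℝ × ℝ)} (h : R.card ≤ n + 1) : Indep n R := by
  classical
  intro v
  let form (P Q : ℝ × ℝ) : MvPolynomial (Fin 2) ℝ :=
    C (P.1 - Q.1) * X 0 + C (P.2 - Q.2) * X 1 + C (-(P.1 - Q.1) * Q.1 - (P.2 - Q.2) * Q.2)
  have hform : ∀ P Q Z, ev (form P Q) Z =
      (P.1 - Q.1) * (Z.1 - Q.1) + (P.2 - Q.2) * (Z.2 - Q.2) := by
    intro P Q Z
    simp only [form, ev_add, ev_mul, ev_C, ev_X_zero, ev_X_one]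
    ring
  have hne : ∀ P Q, P ≠ Q → ev (form P Q) P ≠ 0 := by
    intro P Q hPQ h0
    rw [hform] at h0
    apply hPQ
    exact Prod.ext (by nlinarith [sq_nonneg (P.1 - Q.1), sq_nonneg (P.2 - Q.2)])
      (by nlinarith [sq_nonneg (P.1 - Q.1), sq_nonneg (P.2 - Q.2)])
  let c (P : ℝ × ℝ) : ℝ := ∏ Q ∈ R.erase P, ev (form P Q) P
  have hc : ∀ P, c P ≠ 0 := fun P =>
    Finset.prod_ne_zero_iff.mpr fun Q hQ => hne P Q (Finset.ne_of_mem_erase hQ).symm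
  refine ⟨∑ P ∈ R, C (v P / c P) * ∏ Q ∈ R.erase P, form P Q, ?_, ?_⟩
  · refine totalDegree_finsetSum_le fun P hP => (totalDegree_mul _ _).trans ?_
    rw [totalDegree_C, zero_add]
    refine (totalDegree_finsetProd _ _).trans ((Finset.sum_le_card_nsmul _ _ 1 ?_).trans ?_)
    · intro Q hQ
      exact (isLinePoly_of_coeffs _ (by
        by_contra! h0
        exact (Finset.ne_of_mem_erase hQ)
          (Prod.ext (by linarith [h0.1]) (by linarith [h0.2])))).le
    · rw [Finset.card_erase_of_mem hP]; simp; omega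
  · intro P hP
    rw [ev_sum, Finset.sum_eq_single P]
    · rw [ev_mul, ev_C, ev_prod]
      exact div_mul_cancel₀ _ (hc P)
    · intro Q _ hQP
      rw [ev_mul, ev_prod, Finset.prod_eq_zero (i := P), mul_zero]
      · exact Finset.mem_erase.mpr ⟨hQP.symm, hP⟩
      · rw [hform]; ring
    · exact fun h => absurd hP h

lemma Indep.union_line {n : ℕ} {S R : Finset (ℝ × ℝ)} (h : Indep n S)
    {l : MvPolynomial (Fin 2) ℝ} (hl : IsLinePoly l) (hS : ∀ P ∈ S, ev l P ≠ 0)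
    (hR : ∀ P ∈ R, ev l P = 0) (hc : R.card ≤ n + 2) : Indep (n + 1) (R ∪ S) := by
  intro v
  obtain ⟨q, hq, hqv⟩ := indep_of_card_le (n := n + 1) hc v
  obtain ⟨r, hr, hrv⟩ := h (fun P => (v P - ev q P) / ev l P)
  refine ⟨q + l * r, (totalDegree_add _ _).trans (max_le hq ((totalDegree_mul _ _).trans ?_)), ?_⟩
  · rw [IsLinePoly] at hl; omega
  · intro P hP
    rw [ev_add, ev_mul]
    rcases Finset.mem_union.mp hP with hP | hP
    · rw [hR P hP, hqv P hP]; ring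
    · rw [hrv P hP, mul_div_cancel₀ _ (hS P hP)]; ring

lemma IsLinePoly.exists_mem_notMem {l : MvPolynomial (Fin 2) ℝ} (hl : IsLinePoly l)
    {S : Set (ℝ × ℝ)} (hS : S.Finite) : ∃ P, P ∈ lineSet l ∧ P ∉ S := by
  obtain ⟨a, b, c, hN, rfl⟩ := hl.exists_coeffs
  set N := a ^ 2 + b ^ 2 with hNdef
  let γ (t : ℝ) : ℝ × ℝ := ((b * t - a * c) / N, (-a * t - b * c) / N)
  have hγ : Function.Injective γ := by
    intro s t h
    have h1 : (b * s - a * c) / N = (b * t - a * c) / N := congr_arg Prod.fst h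
    have h2 : (-a * s - b * c) / N = (-a * t - b * c) / N := congr_arg Prod.snd h
    rw [div_left_inj' hN] at h1 h2
    have : N * (s - t) = 0 := by rw [hNdef]; linear_combination b * h1 - a * h2
    linarith [(mul_eq_zero.mp this).resolve_left hN]
  obtain ⟨P, ⟨t, rfl⟩, hP⟩ := (Set.infinite_range_of_injective hγ).exists_notMem_finite hS
  refine ⟨γ t, ?_, hP⟩
  simp only [lineSet, Set.mem_ofPred_eq, ev_add, ev_mul, ev_C, ev_X_zero, ev_X_one, γ]
  field_simp
  rw [hNdef]
  ring

/-- A line of the plane, as a set of points. -/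
def IsLine (f : Set (ℝ × ℝ)) : Prop := ∃ l, IsLinePoly l ∧ lineSet l = f

lemma mem_lineSet {l : MvPolynomial (Fin 2) ℝ} {P : ℝ × ℝ} : P ∈ lineSet l ↔ ev l P = 0 := Iff.rfl

lemma IsLine.exists_mem_notMem {f : Set (ℝ × ℝ)} (hf : IsLine f) {S : Set (ℝ × ℝ)}
    (hS : S.Finite) : ∃ P, P ∈ f ∧ P ∉ S := by
  obtain ⟨l, hl, rfl⟩ := hf
  exact hl.exists_mem_notMem hS

lemma IsLine.subset_of_two {f f' : Set (ℝ × ℝ)} (hf : IsLine f) (hf' : IsLine f')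
    {P Q : ℝ × ℝ} (hPQ : P ≠ Q) (hP : P ∈ f) (hQ : Q ∈ f) (hP' : P ∈ f') (hQ' : Q ∈ f') :
    f ⊆ f' := by
  classical
  obtain ⟨l, hl, rfl⟩ := hf
  obtain ⟨l', hl', rfl⟩ := hf'
  obtain ⟨q, -, h⟩ := hl.exists_eq_mul (n := 1) (p := l') hl'.le (S := {P, Q})
    (by simp only [Finset.mem_insert, Finset.mem_singleton]; rintro _ (rfl | rfl) <;> tauto)
    (by rw [Finset.card_pair hPQ]; norm_num)
  intro Z hZ
  rw [mem_lineSet] at hZ ⊢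
  rw [h, ev_mul, hZ, zero_mul]

lemma IsLine.eq_of_two {f f' : Set (ℝ × ℝ)} (hf : IsLine f) (hf' : IsLine f')
    {P Q : ℝ × ℝ} (hPQ : P ≠ Q) (hP : P ∈ f) (hQ : Q ∈ f) (hP' : P ∈ f') (hQ' : Q ∈ f') :
    f = f' :=
  (hf.subset_of_two hf' hPQ hP hQ hP' hQ').antisymm (hf'.subset_of_two hf hPQ hP' hQ' hP hQ)

end PlanePolynomials

section Configurations

open scoped Classical in
/-- The nodes of `X` lying on `f`. -/
noncomputable def nds (X : Finset (ℝ × ℝ)) (f : Set (ℝ × ℝ)) : Finset (ℝ × ℝ) :=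
  X.filter (· ∈ f)

lemma mem_nds {X : Finset (ℝ × ℝ)} {f : Set (ℝ × ℝ)} {P : ℝ × ℝ} :
    P ∈ nds X f ↔ P ∈ X ∧ P ∈ f := by simp [nds]

/-- The line `f` is one of the five lines assigned to the node `B`. -/
def UsesLine (g : ℝ × ℝ → Fin 5 → Set (ℝ × ℝ)) (B : ℝ × ℝ) (f : Set (ℝ × ℝ)) : Prop :=
  ∃ i, g B i = f

open scoped Classical in
/-- The nodes of `X` which use the line `f`. -/
noncomputable def users (X : Finset (ℝ × ℝ)) (g : ℝ × ℝ → Fin 5 → Set (ℝ × ℝ))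
    (f : Set (ℝ × ℝ)) : Finset (ℝ × ℝ) :=
  X.filter (UsesLine g · f)

lemma mem_users {X : Finset (ℝ × ℝ)} {g : ℝ × ℝ → Fin 5 → Set (ℝ × ℝ)} {f : Set (ℝ × ℝ)}
    {P : ℝ × ℝ} : P ∈ users X g f ↔ P ∈ X ∧ UsesLine g P f := by simp [users]

/-- A `GC_5` set `X` without maximal lines, together with the five lines `g B 0, …, g B 4` whose
equations multiply to the fundamental polynomial of the node `B`. -/
structure GCConf (X : Finset (ℝ × ℝ)) (g : ℝ × ℝ → Fin 5 → Set (ℝ × ℝ)) : Prop where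
  card : X.card = 21
  line : ∀ B ∈ X, ∀ i, IsLine (g B i)
  notMem : ∀ B ∈ X, ∀ i, B ∉ g B i
  cover : ∀ B ∈ X, ∀ P ∈ X, P ≠ B → ∃ i, P ∈ g B i
  poised : ∀ p : MvPolynomial (Fin 2) ℝ, p.totalDegree ≤ 5 → (∀ P ∈ X, ev p P = 0) → p = 0
  card_le : ∀ f, IsLine f → (nds X f).card ≤ 5

/-- Three lines with five nodes each and no common node. -/
structure Triple (X : Finset (ℝ × ℝ)) (K : Fin 3 → Set (ℝ × ℝ)) : Prop where
  line : ∀ i, IsLine (K i)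
  card : ∀ i, (nds X (K i)).card = 5
  disj : ∀ i j, i ≠ j → ∀ P ∈ X, P ∈ K i → P ∉ K j

section Residual

open scoped Classical in
/-- The successive numbers of points of `T` on the lines of a list which are on no earlier line. -/
noncomputable def res : Finset (ℝ × ℝ) → List (Set (ℝ × ℝ)) → List ℕ
  | _, [] => []
  | T, l :: L => (T.filter (· ∈ l)).card :: res (T.filter (· ∉ l)) L

open scoped Classical in
lemma exists_of_mem_res {L : List (Set (ℝ × ℝ))} : ∀ {T : Finset (ℝ × ℝ)} {x : ℕ}, x ∈ res T L →
    ∃ l ∈ L, x ≤ (T.filter (· ∈ l)).card := by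
  induction L with
  | nil => intro T x hx; simp [res] at hx
  | cons l L ih =>
    intro T x hx
    rw [res, List.mem_cons] at hx
    rcases hx with rfl | hx
    · exact ⟨l, by simp, le_rfl⟩
    · obtain ⟨m, hm, h⟩ := ih hx
      exact ⟨m, List.mem_cons_of_mem _ hm,
        h.trans (Finset.card_le_card (Finset.filter_subset_filter _ (Finset.filter_subset _ _)))⟩

open scoped Classical in
lemma exists_greedy (n : ℕ) : ∀ (L : List (Set (ℝ × ℝ))) (T : Finset (ℝ × ℝ)), L.length = n →
    ∃ L', L'.Perm L ∧ (res T L').Pairwise (· ≥ ·) := by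
  induction n with
  | zero =>
    intro L T hL
    rw [List.length_eq_zero_iff] at hL
    exact ⟨[], by simp [hL], by simp [res]⟩
  | succ n ih =>
    intro L T hL
    have hne : L.toFinset.Nonempty := by
      rw [List.toFinset_nonempty_iff]; rintro rfl; simp at hL
    obtain ⟨l, hl, hmax⟩ :=
      Finset.exists_max_image L.toFinset (fun l => (T.filter (· ∈ l)).card) hne
    rw [List.mem_toFinset] at hl
    obtain ⟨L', hp, hs⟩ := ih (L.erase l) (T.filter (· ∉ l)) (by
      rw [List.length_erase_of_mem hl]; omega)
    refine ⟨l :: L', (hp.cons l).trans (List.perm_cons_erase hl).symm, ?_⟩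
    rw [res, List.pairwise_cons]
    refine ⟨fun x hx => ?_, hs⟩
    obtain ⟨m, hm, h⟩ := exists_of_mem_res hx
    have h2 := hmax m (List.mem_toFinset.mpr (List.mem_of_mem_erase (hp.mem_iff.mp hm)))
    exact (h.trans (Finset.card_le_card
      (Finset.filter_subset_filter _ (Finset.filter_subset _ _)))).trans h2

end Residual

lemma Indep.union_dual {n : ℕ} {S U : Finset (ℝ × ℝ)} (h : Indep n S)
    (w : ∀ B ∈ U, ∃ q : MvPolynomial (Fin 2) ℝ, q.totalDegree ≤ n ∧ ev q B ≠ 0 ∧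
      (∀ P ∈ S, ev q P = 0) ∧ ∀ P ∈ U, P ≠ B → ev q P = 0) :
    ∀ v : ℝ × ℝ → ℝ, ∃ q : MvPolynomial (Fin 2) ℝ, q.totalDegree ≤ n ∧
      (∀ P ∈ S, ev q P = v P) ∧ ∀ P ∈ U, ev q P = v P := by
  classical
  intro v
  obtain ⟨r, hr, hrv⟩ := h v
  choose! q hq hqB hqS hqU using w
  refine ⟨r + ∑ B ∈ U, C ((v B - ev r B) / ev (q B) B) * q B, ?_, ?_, ?_⟩
  · refine (totalDegree_add _ _).trans (max_le hr (totalDegree_finsetSum_le fun B hB => ?_))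
    refine (totalDegree_mul _ _).trans ?_
    rw [totalDegree_C, zero_add]
    exact hq B hB
  · intro P hP
    rw [ev_add, ev_sum, Finset.sum_eq_zero, hrv P hP, add_zero]
    intro B hB
    rw [ev_mul, hqS B hB P hP, mul_zero]
  · intro P hP
    rw [ev_add, ev_sum, Finset.sum_eq_single P]
    · rw [ev_mul, ev_C, div_mul_cancel₀ _ (hqB P hP)]; ring
    · intro B hB hBP
      rw [ev_mul, hqU B hB P hP hBP.symm, mul_zero]
    · exact fun h => absurd hP h

namespace GCConf

variable {X : Finset (ℝ × ℝ)} {g : ℝ × ℝ → Fin 5 → Set (ℝ × ℝ)}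

lemma exists_quartic (h : GCConf X g) {B : ℝ × ℝ} (hB : B ∈ X) (i₀ : Fin 5) :
    ∃ q : MvPolynomial (Fin 2) ℝ, q.totalDegree ≤ 4 ∧
      ∀ P, ev q P = 0 ↔ ∃ i, i ≠ i₀ ∧ P ∈ g B i := by
  choose L hL hLg using h.line B hB
  refine ⟨∏ i ∈ Finset.univ.erase i₀, L i, ?_, ?_⟩
  · refine (totalDegree_finsetProd _ _).trans ((Finset.sum_le_card_nsmul _ _ 1 ?_).trans ?_)
    · exact fun i _ => (hL i).le
    · simp
  · intro P
    rw [ev_prod, Finset.prod_eq_zero_iff]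
    simp only [Finset.mem_erase, Finset.mem_univ, and_true, ← hLg]
    rfl

lemma exists_fund (h : GCConf X g) {B : ℝ × ℝ} (hB : B ∈ X) :
    ∃ p : MvPolynomial (Fin 2) ℝ, p.totalDegree ≤ 5 ∧ ∀ P, ev p P = 0 ↔ ∃ i, P ∈ g B i := by
  choose L hL hLg using h.line B hB
  refine ⟨∏ i, L i, ?_, ?_⟩
  · refine (totalDegree_finsetProd _ _).trans ((Finset.sum_le_card_nsmul _ _ 1 ?_).trans ?_)
    · exact fun i _ => (hL i).le
    · simp
  · intro P
    rw [ev_prod, Finset.prod_eq_zero_iff]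
    simp only [Finset.mem_univ, true_and, ← hLg]
    rfl

lemma usesLine_line (h : GCConf X g) {B : ℝ × ℝ} (hB : B ∈ X) {f : Set (ℝ × ℝ)}
    (hu : UsesLine g B f) : IsLine f := by
  obtain ⟨i, rfl⟩ := hu
  exact h.line B hB i

lemma usesLine_notMem (h : GCConf X g) {B : ℝ × ℝ} (hB : B ∈ X) {f : Set (ℝ × ℝ)}
    (hu : UsesLine g B f) : B ∉ f := by
  obtain ⟨i, rfl⟩ := hu
  exact h.notMem B hB i

/-- A nonzero polynomial of degree at most five vanishing at all nodes but `B` and on a whole line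
shows that `B` uses that line. -/
lemma usesLine_of_poly (h : GCConf X g) {B : ℝ × ℝ} (hB : B ∈ X) {p : MvPolynomial (Fin 2) ℝ}
    (hp0 : p ≠ 0) (hp : p.totalDegree ≤ 5) (hpX : ∀ P ∈ X, P ≠ B → ev p P = 0)
    {f : Set (ℝ × ℝ)} (hf : IsLine f) (hpf : ∀ P ∈ f, ev p P = 0) : UsesLine g B f := by
  obtain ⟨r, hr, hrz⟩ := h.exists_fund hB
  have hrB : ev r B ≠ 0 := by
    rw [Ne, hrz]; rintro ⟨i, hi⟩; exact h.notMem B hB i hi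
  have hpB : ev p B ≠ 0 := by
    intro h0
    refine hp0 (h.poised p hp fun P hP => ?_)
    by_cases hPB : P = B
    · rw [hPB, h0]
    · exact hpX P hP hPB
  have hprop : C (ev r B) * p - C (ev p B) * r = 0 := by
    refine h.poised _ ((totalDegree_sub _ _).trans (max_le ?_ ?_)) ?_
    · exact (totalDegree_mul _ _).trans (by simpa using hp)
    · exact (totalDegree_mul _ _).trans (by simpa using hr)
    · intro P hP
      simp only [ev_sub, ev_mul, ev_C]
      by_cases hPB : P = B
      · rw [hPB]; ring
      · rw [hpX P hP hPB, (hrz P).mpr (h.cover B hB P hP hPB)]; ring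
  by_contra hno
  have hsub : ∀ i, (f ∩ g B i).Subsingleton := by
    rintro i P ⟨hP, hP'⟩ Q ⟨hQ, hQ'⟩
    by_contra hPQ
    exact hno ⟨i, (hf.eq_of_two (h.line B hB i) hPQ hP hQ hP' hQ').symm⟩
  obtain ⟨P, hPf, hP⟩ := hf.exists_mem_notMem (S := ⋃ i, f ∩ g B i)
    (Set.finite_iUnion fun i => (hsub i).finite)
  have h1 := congr_arg (ev · P) hprop
  simp only [ev_sub, ev_mul, ev_C, ev_zero, hpf P hPf, mul_zero, zero_sub, neg_eq_zero,
    mul_eq_zero, hpB, false_or] at h1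
  obtain ⟨i, hi⟩ := (hrz P).mp h1
  exact hP (Set.mem_iUnion.mpr ⟨i, hPf, hi⟩)

open scoped Classical in
/-- The lines of a user `B` of `f` other than `f`, ordered greedily with respect to the nodes that
neither lie on `f` nor use `f`, and the dimension bound for quartics. -/
lemma exists_rank (h : GCConf X g) {B : ℝ × ℝ} {f : Set (ℝ × ℝ)} (hB : B ∈ users X g f)
    {T : Finset (ℝ × ℝ)} (hT : T = X.filter (fun P => P ∉ f ∧ P ∉ users X g f)) :
    ∃ l₁ l₂ l₃ l₄ : Set (ℝ × ℝ), UsesLine g B l₁ ∧ UsesLine g B l₂ ∧ UsesLine g B l₃ ∧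
      UsesLine g B l₄ ∧ ∃ t₁ t₂ t₃ t₄ : ℕ,
      t₁ = (T.filter (· ∈ l₁)).card ∧ t₂ = ((T.filter (· ∉ l₁)).filter (· ∈ l₂)).card ∧
      t₃ = (((T.filter (· ∉ l₁)).filter (· ∉ l₂)).filter (· ∈ l₃)).card ∧
      t₄ ≤ t₃ ∧ t₃ ≤ t₂ ∧ t₂ ≤ t₁ ∧ t₁ ≤ 5 ∧
      t₁ + t₂ + t₃ + t₄ + (nds X f).card + (users X g f).card = 21 ∧
      (users X g f).card + min t₁ 5 + min t₂ 4 + min t₃ 3 + min t₄ 2 ≤ 15 := by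
  obtain ⟨hBX, i₀, hi₀⟩ := mem_users.mp hB
  have hidx : ∀ i₀ : Fin 5, ∃ j₁ j₂ j₃ j₄ : Fin 5,
      ∀ i, i = i₀ ∨ i = j₁ ∨ i = j₂ ∨ i = j₃ ∨ i = j₄ := by decide
  obtain ⟨j₁, j₂, j₃, j₄, hj⟩ := hidx i₀
  obtain ⟨L', hperm, hsort⟩ := exists_greedy 4 [g B j₁, g B j₂, g B j₃, g B j₄] T rfl
  have hlen := hperm.length_eq
  match L', hlen with
  | [l₁, l₂, l₃, l₄], _ =>
  have hmem : ∀ l ∈ [l₁, l₂, l₃, l₄], UsesLine g B l := by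
    intro l hl
    rw [hperm.mem_iff] at hl
    simp only [List.mem_cons, List.not_mem_nil, or_false] at hl
    rcases hl with rfl | rfl | rfl | rfl <;> exact ⟨_, rfl⟩
  have hu₁ := hmem l₁ (by simp)
  have hu₂ := hmem l₂ (by simp)
  have hu₃ := hmem l₃ (by simp)
  have hu₄ := hmem l₄ (by simp)
  have hcov : ∀ P ∈ T, P ∈ l₁ ∨ P ∈ l₂ ∨ P ∈ l₃ ∨ P ∈ l₄ := by
    intro P hP
    rw [hT, Finset.mem_filter] at hP
    obtain ⟨i, hi⟩ := h.cover B hBX P hP.1 (by rintro rfl; exact hP.2.2 hB)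
    have hl : g B i ∈ [g B j₁, g B j₂, g B j₃, g B j₄] := by
      rcases hj i with rfl | rfl | rfl | rfl | rfl
      · rw [hi₀] at hi; exact absurd hi hP.2.1
      all_goals simp
    rw [← hperm.mem_iff] at hl
    simp only [List.mem_cons, List.not_mem_nil, or_false] at hl
    rcases hl with e | e | e | e <;> rw [e] at hi <;> tauto
  simp only [res, List.pairwise_cons, List.mem_cons, List.not_mem_nil, or_false, forall_eq_or_imp,
    forall_eq, ge_iff_le] at hsort
  set T₁ := T.filter (· ∉ l₁) with hT₁
  set T₂ := T₁.filter (· ∉ l₂) with hT₂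
  set T₃ := T₂.filter (· ∉ l₃) with hT₃
  have e₁ : (T.filter (· ∈ l₁)).card + T₁.card = T.card := Finset.card_filter_add_card_filter_not _
  have e₂ : (T₁.filter (· ∈ l₂)).card + T₂.card = T₁.card :=
    Finset.card_filter_add_card_filter_not _
  have e₃ : (T₂.filter (· ∈ l₃)).card + T₃.card = T₂.card :=
    Finset.card_filter_add_card_filter_not _
  have e₄ : (T₃.filter (· ∈ l₄)).card = T₃.card := by
    rw [Finset.filter_true_of_mem]
    intro P hP
    simp only [hT₃, hT₂, hT₁, Finset.mem_filter] at hP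
    have := hcov P hP.1.1.1
    tauto
  have hUf : ∀ P ∈ users X g f, P ∉ f := fun P hP =>
    h.usesLine_notMem (mem_users.mp hP).1 (mem_users.mp hP).2
  have eT : T.card + (nds X f).card + (users X g f).card = 21 := by
    have hd : Disjoint T (nds X f ∪ users X g f) := by
      rw [Finset.disjoint_left]
      intro P hP hP'
      rw [hT, Finset.mem_filter] at hP
      rcases Finset.mem_union.mp hP' with hP' | hP'
      · exact hP.2.1 (mem_nds.mp hP').2
      · exact hP.2.2 hP'
    have hd2 : Disjoint (nds X f) (users X g f) := by
      rw [Finset.disjoint_left]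
      exact fun P hP hP' => hUf P hP' (mem_nds.mp hP).2
    rw [add_assoc, ← Finset.card_union_of_disjoint hd2, ← Finset.card_union_of_disjoint hd,
      ← h.card]
    congr 1
    ext P
    simp only [hT, Finset.mem_union, Finset.mem_filter, mem_nds, mem_users]
    tauto
  have ht₁ : (T.filter (· ∈ l₁)).card ≤ 5 := by
    refine (Finset.card_le_card ?_).trans (h.card_le l₁ (h.usesLine_line hBX hu₁))
    intro P hP
    rw [hT, Finset.mem_filter, Finset.mem_filter] at hP
    exact mem_nds.mpr ⟨hP.1.1, hP.2⟩
  refine ⟨l₁, l₂, l₃, l₄, hu₁, hu₂, hu₃, hu₄, (T.filter (· ∈ l₁)).card,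
    (T₁.filter (· ∈ l₂)).card, (T₂.filter (· ∈ l₃)).card, (T₃.filter (· ∈ l₄)).card, rfl, rfl, rfl,
    hsort.2.2.1, hsort.2.1.1, hsort.1.1, ht₁, by omega, ?_⟩
  obtain ⟨S₁, hS₁, c₁⟩ := Finset.exists_subset_card_eq (min_le_left (T.filter (· ∈ l₁)).card 5)
  obtain ⟨S₂, hS₂, c₂⟩ := Finset.exists_subset_card_eq (min_le_left (T₁.filter (· ∈ l₂)).card 4)
  obtain ⟨S₃, hS₃, c₃⟩ := Finset.exists_subset_card_eq (min_le_left (T₂.filter (· ∈ l₃)).card 3)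
  obtain ⟨S₄, hS₄, c₄⟩ := Finset.exists_subset_card_eq (min_le_left (T₃.filter (· ∈ l₄)).card 2)
  have m₁ : ∀ P ∈ S₁, P ∈ T ∧ P ∈ l₁ := fun P hP => by
    simpa only [Finset.mem_filter] using hS₁ hP
  have m₂ : ∀ P ∈ S₂, P ∈ T ∧ P ∉ l₁ ∧ P ∈ l₂ := fun P hP => by
    simpa only [Finset.mem_filter, hT₁, and_assoc] using hS₂ hP
  have m₃ : ∀ P ∈ S₃, P ∈ T ∧ P ∉ l₁ ∧ P ∉ l₂ ∧ P ∈ l₃ := fun P hP => by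
    simpa only [Finset.mem_filter, hT₁, hT₂, and_assoc] using hS₃ hP
  have m₄ : ∀ P ∈ S₄, P ∈ T ∧ P ∉ l₁ ∧ P ∉ l₂ ∧ P ∉ l₃ ∧ P ∈ l₄ := fun P hP => by
    simpa only [Finset.mem_filter, hT₁, hT₂, hT₃, and_assoc] using hS₄ hP
  obtain ⟨p₁, hp₁, q₁⟩ := h.usesLine_line hBX hu₁
  obtain ⟨p₂, hp₂, q₂⟩ := h.usesLine_line hBX hu₂
  obtain ⟨p₃, hp₃, q₃⟩ := h.usesLine_line hBX hu₃
  have i₁ : Indep 1 S₄ := indep_of_card_le (by rw [c₄]; exact min_le_right _ _)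
  have i₂ : Indep 2 (S₃ ∪ S₄) := i₁.union_line hp₃ (fun P hP => by
      rw [Ne, ← mem_lineSet, q₃]; exact (m₄ P hP).2.2.2.1) (fun P hP => by
      rw [← mem_lineSet, q₃]; exact (m₃ P hP).2.2.2) (by rw [c₃]; exact min_le_right _ _)
  have i₃ : Indep 3 (S₂ ∪ (S₃ ∪ S₄)) := i₂.union_line hp₂ (fun P hP => by
      rw [Ne, ← mem_lineSet, q₂]
      rcases Finset.mem_union.mp hP with hP | hP
      · exact (m₃ P hP).2.2.1
      · exact (m₄ P hP).2.2.1) (fun P hP => by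
      rw [← mem_lineSet, q₂]; exact (m₂ P hP).2.2) (by rw [c₂]; exact min_le_right _ _)
  have i₄ : Indep 4 (S₁ ∪ (S₂ ∪ (S₃ ∪ S₄))) := i₃.union_line hp₁ (fun P hP => by
      rw [Ne, ← mem_lineSet, q₁]
      simp only [Finset.mem_union] at hP
      rcases hP with hP | hP | hP
      · exact (m₂ P hP).2.1
      · exact (m₃ P hP).2.1
      · exact (m₄ P hP).2.1) (fun P hP => by
      rw [← mem_lineSet, q₁]; exact (m₁ P hP).2) (by rw [c₁]; exact min_le_right _ _)
  have hST : ∀ P ∈ S₁ ∪ (S₂ ∪ (S₃ ∪ S₄)), P ∈ T := by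
    intro P hP
    simp only [Finset.mem_union] at hP
    rcases hP with hP | hP | hP | hP
    · exact (m₁ P hP).1
    · exact (m₂ P hP).1
    · exact (m₃ P hP).1
    · exact (m₄ P hP).1
  have i₅ : Indep 4 (users X g f ∪ (S₁ ∪ (S₂ ∪ (S₃ ∪ S₄)))) := by
    intro v
    obtain ⟨q, hq, hqS, hqU⟩ := i₄.union_dual (U := users X g f) (fun D hD => by
      obtain ⟨hDX, k, hk⟩ := mem_users.mp hD
      obtain ⟨q, hq, hqz⟩ := h.exists_quartic hDX k
      have hz : ∀ P ∈ X, P ≠ D → P ∉ f → ev q P = 0 := by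
        intro P hP hPD hPf
        obtain ⟨i, hi⟩ := h.cover D hDX P hP hPD
        exact (hqz P).mpr ⟨i, by rintro rfl; rw [hk] at hi; exact hPf hi, hi⟩
      refine ⟨q, hq, ?_, ?_, ?_⟩
      · rw [Ne, hqz]; rintro ⟨i, -, hi⟩; exact h.notMem D hDX i hi
      · intro P hP
        have hP := hST P hP
        rw [hT, Finset.mem_filter] at hP
        exact hz P hP.1 (by rintro rfl; exact hP.2.2 hD) hP.2.1
      · exact fun P hP hPD => hz P (mem_users.mp hP).1 hPD (hUf P hP)) v
    refine ⟨q, hq, fun P hP => ?_⟩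
    rcases Finset.mem_union.mp hP with hP | hP
    · exact hqU P hP
    · exact hqS P hP
  have hcard := i₅.card_le
  have d₃ : Disjoint S₃ S₄ := Finset.disjoint_left.mpr fun P hP hP' =>
    (m₄ P hP').2.2.2.1 (m₃ P hP).2.2.2
  have d₂ : Disjoint S₂ (S₃ ∪ S₄) := Finset.disjoint_left.mpr fun P hP hP' => by
    rcases Finset.mem_union.mp hP' with hP' | hP'
    · exact (m₃ P hP').2.2.1 (m₂ P hP).2.2
    · exact (m₄ P hP').2.2.1 (m₂ P hP).2.2
  have d₁ : Disjoint S₁ (S₂ ∪ (S₃ ∪ S₄)) := Finset.disjoint_left.mpr fun P hP hP' => by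
    simp only [Finset.mem_union] at hP'
    rcases hP' with hP' | hP' | hP'
    · exact (m₂ P hP').2.1 (m₁ P hP).2
    · exact (m₃ P hP').2.1 (m₁ P hP).2
    · exact (m₄ P hP').2.1 (m₁ P hP).2
  have d₀ : Disjoint (users X g f) (S₁ ∪ (S₂ ∪ (S₃ ∪ S₄))) :=
    Finset.disjoint_left.mpr fun P hP hP' => by
      have := hST P hP'
      rw [hT, Finset.mem_filter] at this
      exact this.2.2 hP
  rw [Finset.card_union_of_disjoint d₀, Finset.card_union_of_disjoint d₁,
    Finset.card_union_of_disjoint d₂, Finset.card_union_of_disjoint d₃, c₁, c₂, c₃, c₄] at hcard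
  have h15 : ((Finset.range (4 + 1) ×ˢ Finset.range (4 + 1)).filter
      (fun x => x.1 + x.2 ≤ 4)).card = 15 := by decide
  omega

end GCConf

end Configurations

section Counting

open scoped Classical in
lemma sum_card_pencil_le {F : Finset (Set (ℝ × ℝ))} {S : Finset (ℝ × ℝ)} {z : ℝ × ℝ} (hz : z ∉ S)
    (hF : ∀ f ∈ F, IsLine f ∧ z ∈ f) : ∑ f ∈ F, (nds S f).card ≤ S.card := by
  rw [← Finset.card_biUnion]
  · refine Finset.card_le_card (Finset.biUnion_subset.mpr fun f _ => Finset.filter_subset _ _)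
  · intro f hf f' hf' hne
    rw [Function.onFun, Finset.disjoint_left]
    intro P hP hP'
    rw [mem_nds] at hP hP'
    exact hne ((hF f hf).1.eq_of_two (hF f' hf').1 (by rintro rfl; exact hz hP.1) hP.2
      (hF f hf).2 hP'.2 (hF f' hf').2)

/-- A node all of whose five lines contain exactly four nodes, without common nodes. -/
structure FourNode (X : Finset (ℝ × ℝ)) (g : ℝ × ℝ → Fin 5 → Set (ℝ × ℝ)) (A : ℝ × ℝ) :
    Prop where
  mem : A ∈ X
  card : ∀ i, (nds X (g A i)).card = 4
  disj : ∀ i j, i ≠ j → ∀ P ∈ X, P ∈ g A i → P ∉ g A j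

namespace GCConf

variable {X : Finset (ℝ × ℝ)} {g : ℝ × ℝ → Fin 5 → Set (ℝ × ℝ)}

open scoped Classical in
lemma full_of_card (h : GCConf X g) {l : Set (ℝ × ℝ)} (hl : IsLine l) {T : Finset (ℝ × ℝ)}
    (hT : T ⊆ X) (hc : (T.filter (· ∈ l)).card = 5) :
    (nds X l).card = 5 ∧ ∀ P ∈ X, P ∈ l → P ∈ T := by
  have hsub : T.filter (· ∈ l) ⊆ nds X l := Finset.filter_subset_filter _ hT
  have hle := h.card_le l hl
  have heq := Finset.eq_of_subset_of_card_le hsub (by omega)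
  refine ⟨by rw [← heq, hc], fun P hP hPl => ?_⟩
  have : P ∈ T.filter (· ∈ l) := by rw [heq, mem_nds]; exact ⟨hP, hPl⟩
  exact Finset.mem_of_mem_filter _ this

lemma triple_mk {l₀ l₁ l₂ : Set (ℝ × ℝ)} (h₀ : IsLine l₀) (h₁ : IsLine l₁) (h₂ : IsLine l₂)
    (c₀ : (nds X l₀).card = 5) (c₁ : (nds X l₁).card = 5) (c₂ : (nds X l₂).card = 5)
    (d₀₁ : ∀ P ∈ X, P ∈ l₀ → P ∉ l₁) (d₀₂ : ∀ P ∈ X, P ∈ l₀ → P ∉ l₂)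
    (d₁₂ : ∀ P ∈ X, P ∈ l₁ → P ∉ l₂) : Triple X ![l₀, l₁, l₂] where
  line i := by fin_cases i <;> assumption
  card i := by fin_cases i <;> assumption
  disj i j hij P hP := by
    have a := d₀₁ P hP
    have b := d₀₂ P hP
    have c := d₁₂ P hP
    fin_cases i <;> fin_cases j <;> simp at hij ⊢ <;> tauto

lemma users_lt_of_no_triple (h : GCConf X g) (hno : ∀ K, ¬ Triple X K) {f : Set (ℝ × ℝ)}
    (hf : 1 ≤ (nds X f).card) : (users X g f).card + 1 ≤ (nds X f).card := by
  classical
  rcases (users X g f).eq_empty_or_nonempty with he | ⟨B, hB⟩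
  · rw [he]; simpa using hf
  have hBX := (mem_users.mp hB).1
  have hfl := h.usesLine_line hBX (mem_users.mp hB).2
  have h5 := h.card_le f hfl
  obtain ⟨l₁, l₂, l₃, l₄, u₁, u₂, u₃, -, t₁, t₂, t₃, t₄, e₁, e₂, e₃, h₄, h₃, h₂, h₁, hs, hr⟩ :=
    h.exists_rank hB rfl
  set T := X.filter (fun P => P ∉ f ∧ P ∉ users X g f) with hT
  have s₁ : T ⊆ X := Finset.filter_subset _ _
  have s₂ : T.filter (· ∉ l₁) ⊆ X := (Finset.filter_subset _ _).trans s₁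
  have s₃ : (T.filter (· ∉ l₁)).filter (· ∉ l₂) ⊆ X := (Finset.filter_subset _ _).trans s₂
  have i₁ := h.usesLine_line hBX u₁
  have i₂ := h.usesLine_line hBX u₂
  have i₃ := h.usesLine_line hBX u₃
  have n₁ : t₃ ≠ 5 := by
    intro h3
    have f₁ := h.full_of_card i₁ s₁ (by omega)
    have f₂ := h.full_of_card i₂ s₂ (by omega)
    have f₃ := h.full_of_card i₃ s₃ (by omega)
    refine hno _ (triple_mk i₁ i₂ i₃ f₁.1 f₂.1 f₃.1 ?_ ?_ ?_)
    · intro P hP hP1 hP2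
      exact (Finset.mem_filter.mp (f₂.2 P hP hP2)).2 hP1
    · intro P hP hP1 hP2
      exact (Finset.mem_filter.mp (Finset.mem_filter.mp (f₃.2 P hP hP2)).1).2 hP1
    · intro P hP hP1 hP2
      exact (Finset.mem_filter.mp (f₃.2 P hP hP2)).2 hP1
  have n₂ : (nds X f).card = 5 → t₂ ≠ 5 := by
    intro hk h2
    have f₁ := h.full_of_card i₁ s₁ (by omega)
    have f₂ := h.full_of_card i₂ s₂ (by omega)
    refine hno _ (triple_mk hfl i₁ i₂ hk f₁.1 f₂.1 ?_ ?_ ?_)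
    · intro P hP hP1 hP2
      exact (Finset.mem_filter.mp (f₁.2 P hP hP2)).2.1 hP1
    · intro P hP hP1 hP2
      exact (Finset.mem_filter.mp (Finset.mem_filter.mp (f₂.2 P hP hP2)).1).2.1 hP1
    · intro P hP hP1 hP2
      exact (Finset.mem_filter.mp (f₂.2 P hP hP2)).2 hP1
  omega

lemma users_five (h : GCConf X g) {f : Set (ℝ × ℝ)} {B : ℝ × ℝ} (hB : B ∈ users X g f)
    (hf : (nds X f).card = 5) : (users X g f).card ≤ 4 ∨
    ∃ l₁ l₂, UsesLine g B l₁ ∧ UsesLine g B l₂ ∧ Triple X ![f, l₁, l₂] := by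
  classical
  have hBX := (mem_users.mp hB).1
  have hfl := h.usesLine_line hBX (mem_users.mp hB).2
  obtain ⟨l₁, l₂, l₃, l₄, u₁, u₂, u₃, -, t₁, t₂, t₃, t₄, e₁, e₂, e₃, h₄, h₃, h₂, h₁, hs, hr⟩ :=
    h.exists_rank hB rfl
  set T := X.filter (fun P => P ∉ f ∧ P ∉ users X g f) with hT
  have s₁ : T ⊆ X := Finset.filter_subset _ _
  have s₂ : T.filter (· ∉ l₁) ⊆ X := (Finset.filter_subset _ _).trans s₁
  have i₁ := h.usesLine_line hBX u₁
  have i₂ := h.usesLine_line hBX u₂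
  by_cases h2 : t₂ = 5
  · right
    have f₁ := h.full_of_card i₁ s₁ (by omega)
    have f₂ := h.full_of_card i₂ s₂ (by omega)
    refine ⟨l₁, l₂, u₁, u₂, triple_mk hfl i₁ i₂ hf f₁.1 f₂.1 ?_ ?_ ?_⟩
    · intro P hP hP1 hP2
      exact (Finset.mem_filter.mp (f₁.2 P hP hP2)).2.1 hP1
    · intro P hP hP1 hP2
      exact (Finset.mem_filter.mp (Finset.mem_filter.mp (f₂.2 P hP hP2)).1).2.1 hP1
    · intro P hP hP1 hP2
      exact (Finset.mem_filter.mp (f₂.2 P hP hP2)).2 hP1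
  · left
    omega

lemma users_four (h : GCConf X g) {f : Set (ℝ × ℝ)} {B : ℝ × ℝ} (hB : B ∈ users X g f)
    (hf : (nds X f).card = 4) : (users X g f).card ≤ 3 ∧ ((users X g f).card = 3 →
    ∃ l, UsesLine g B l ∧ (nds X l).card = 5 ∧ ∀ P ∈ X, P ∈ l → P ∉ f ∧ P ∉ users X g f) := by
  classical
  have hBX := (mem_users.mp hB).1
  obtain ⟨l₁, l₂, l₃, l₄, u₁, u₂, u₃, -, t₁, t₂, t₃, t₄, e₁, e₂, e₃, h₄, h₃, h₂, h₁, hs, hr⟩ :=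
    h.exists_rank hB rfl
  refine ⟨by omega, fun h3 => ?_⟩
  have f₁ := h.full_of_card (h.usesLine_line hBX u₁) (Finset.filter_subset _ X)
    (e₁.symm.trans (by omega))
  exact ⟨l₁, u₁, f₁.1, fun P hP hPl => (Finset.mem_filter.mp (f₁.2 P hP hPl)).2⟩

lemma users_fourNode (h : GCConf X g) {A : ℝ × ℝ} (hA : FourNode X g A) (i : Fin 5) :
    (users X g (g A i)).card ≤ 2 := by
  classical
  have hu : A ∈ users X g (g A i) := mem_users.mpr ⟨hA.mem, i, rfl⟩
  obtain ⟨l₁, l₂, l₃, l₄, ⟨j, rfl⟩, -, -, -, t₁, t₂, t₃, t₄, e₁, e₂, e₃, h₄, h₃, h₂, h₁, hs, hr⟩ :=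
    h.exists_rank hu rfl
  have h4 := hA.card i
  have ht : t₁ ≤ 4 := by
    rw [e₁, ← hA.card j]
    exact Finset.card_le_card (Finset.filter_subset_filter _ (Finset.filter_subset _ _))
  omega

lemma exists_triple (h : GCConf X g) {A : ℝ × ℝ} (hA : FourNode X g A) : ∃ K, Triple X K := by
  classical
  by_contra! hno
  obtain ⟨c, hc⟩ : (nds X (g A 0)).Nonempty := by
    rw [← Finset.card_pos, hA.card 0]; norm_num
  rw [mem_nds] at hc
  have hφ : ∀ B ∈ X.erase c, ∃ f, UsesLine g B f ∧ c ∈ f ∧ (B = A → f = g A 0) := by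
    intro B hB
    rw [Finset.mem_erase] at hB
    by_cases hBA : B = A
    · exact ⟨g A 0, ⟨0, by rw [hBA]⟩, hc.2, fun _ => rfl⟩
    · obtain ⟨i, hi⟩ := h.cover B hB.2 c hc.1 hB.1.symm
      exact ⟨g B i, ⟨i, rfl⟩, hi, fun e => absurd e hBA⟩
  choose! φ hu hcφ hφA using hφ
  have hcA : A ∈ X.erase c :=
    Finset.mem_erase.mpr ⟨by rintro rfl; exact h.notMem _ hc.1 0 hc.2, hA.mem⟩
  set F := (X.erase c).image φ with hF
  have hFl : ∀ f ∈ F, IsLine f ∧ c ∈ f := by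
    intro f hf
    obtain ⟨B, hB, rfl⟩ := Finset.mem_image.mp hf
    exact ⟨h.usesLine_line (Finset.mem_of_mem_erase hB) (hu B hB), hcφ B hB⟩
  have h1 : (X.erase c).card = ∑ f ∈ F, ((X.erase c).filter (φ · = f)).card :=
    Finset.card_eq_sum_card_fiberwise fun B hB => Finset.mem_image_of_mem φ hB
  have h2 := sum_card_pencil_le (Finset.notMem_erase c X) hFl
  have hfib : ∀ f ∈ F, ((X.erase c).filter (φ · = f)).card ≤ (users X g f).card := by
    intro f _
    refine Finset.card_le_card fun B hB => ?_
    rw [Finset.mem_filter] at hB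
    exact mem_users.mpr ⟨Finset.mem_of_mem_erase hB.1, by rw [← hB.2]; exact hu B hB.1⟩
  have hn : ∀ f ∈ F, (nds (X.erase c) f).card + 1 = (nds X f).card := by
    intro f hf
    have : nds (X.erase c) f = (nds X f).erase c := by
      ext P; simp only [mem_nds, Finset.mem_erase]; tauto
    rw [this]
    exact Finset.card_erase_add_one (mem_nds.mpr ⟨hc.1, (hFl f hf).2⟩)
  have h3 : ∑ f ∈ F, ((X.erase c).filter (φ · = f)).card < ∑ f ∈ F, (nds (X.erase c) f).card := by
    refine Finset.sum_lt_sum (fun f hf => ?_) ⟨g A 0, ?_, ?_⟩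
    · have a := hfib f hf
      have b := hn f hf
      have c := h.users_lt_of_no_triple hno (f := f) (by omega)
      omega
    · exact Finset.mem_image.mpr ⟨A, hcA, hφA A hcA rfl⟩
    · have hf : g A 0 ∈ F := Finset.mem_image.mpr ⟨A, hcA, hφA A hcA rfl⟩
      have a := hfib _ hf
      have b := hn _ hf
      have c := h.users_fourNode hA 0
      have d := hA.card 0
      omega
  omega

end GCConf

end Counting

section Triples

open scoped Classical in
/-- The points of `S` on the lines `K i`. -/
noncomputable def onLines (S : Finset (ℝ × ℝ)) (K : Fin 3 → Set (ℝ × ℝ)) : Finset (ℝ × ℝ) :=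
  S.filter (fun P => ∃ i, P ∈ K i)

open scoped Classical in
/-- The points of `S` on none of the lines `K i`. -/
noncomputable def offLines (S : Finset (ℝ × ℝ)) (K : Fin 3 → Set (ℝ × ℝ)) : Finset (ℝ × ℝ) :=
  S.filter (fun P => ∀ i, P ∉ K i)

lemma mem_onLines {S : Finset (ℝ × ℝ)} {K : Fin 3 → Set (ℝ × ℝ)} {P : ℝ × ℝ} :
    P ∈ onLines S K ↔ P ∈ S ∧ ∃ i, P ∈ K i := by simp [onLines]

lemma mem_offLines {S : Finset (ℝ × ℝ)} {K : Fin 3 → Set (ℝ × ℝ)} {P : ℝ × ℝ} :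
    P ∈ offLines S K ↔ P ∈ S ∧ ∀ i, P ∉ K i := by simp [offLines]

lemma IsLine.card_nds_le_one {f f' : Set (ℝ × ℝ)} (hf : IsLine f) (hf' : IsLine f') (hne : f ≠ f')
    (S : Finset (ℝ × ℝ)) : (nds (nds S f) f').card ≤ 1 := by
  rw [Finset.card_le_one]
  intro P hP Q hQ
  simp only [mem_nds] at hP hQ
  by_contra hPQ
  exact hne (hf.eq_of_two hf' hPQ hP.1.2 hQ.1.2 hP.2 hQ.2)

lemma IsLine.ne_zero_poly {f : Set (ℝ × ℝ)} (hf : IsLine f) :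
    ∃ l : MvPolynomial (Fin 2) ℝ, l ≠ 0 ∧ l.totalDegree = 1 ∧ ∀ P, ev l P = 0 ↔ P ∈ f := by
  obtain ⟨l, hl, rfl⟩ := hf
  refine ⟨l, ?_, hl, fun P => Iff.rfl⟩
  rintro rfl
  simp [IsLinePoly] at hl

namespace Triple

variable {X : Finset (ℝ × ℝ)} {K : Fin 3 → Set (ℝ × ℝ)}

lemma injective (hK : Triple X K) : Function.Injective K := by
  intro i j hij
  by_contra hne
  obtain ⟨P, hP⟩ : (nds X (K i)).Nonempty := by
    rw [← Finset.card_pos, hK.card i]; norm_num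
  rw [mem_nds] at hP
  exact hK.disj i j hne P hP.1 hP.2 (hij ▸ hP.2)

lemma card_on (hK : Triple X K) {S : Finset (ℝ × ℝ)} (hS : S ⊆ X) :
    (onLines S K).card = ∑ i, (nds S (K i)).card := by
  classical
  rw [← Finset.card_biUnion]
  · congr 1
    ext P
    simp [mem_onLines, mem_nds]
  · intro i _ j _ hij
    rw [Function.onFun, Finset.disjoint_left]
    intro P hP hP'
    rw [mem_nds] at hP hP'
    exact hK.disj i j hij P (hS hP.1) hP.2 hP'.2

lemma card_on_add_off (S : Finset (ℝ × ℝ)) (K : Fin 3 → Set (ℝ × ℝ)) :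
    (onLines S K).card + (offLines S K).card = S.card := by
  classical
  rw [← Finset.card_filter_add_card_filter_not (s := S) (fun P => ∃ i, P ∈ K i)]
  simp only [not_exists]
  congr!

lemma card_onLines (hK : Triple X K) : (onLines X K).card = 15 := by
  rw [hK.card_on subset_rfl, Finset.sum_congr rfl (fun i _ => hK.card i)]
  simp

lemma exists_cubic (hK : Triple X K) : ∃ p : MvPolynomial (Fin 2) ℝ, p ≠ 0 ∧ p.totalDegree ≤ 3 ∧
    ∀ P, ev p P = 0 ↔ ∃ i, P ∈ K i := by
  choose l hl0 hl hlz using fun i => (hK.line i).ne_zero_poly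
  refine ⟨∏ i, l i, Finset.prod_ne_zero_iff.mpr fun i _ => hl0 i, ?_, fun P => ?_⟩
  · refine (totalDegree_finsetProd _ _).trans ?_
    simp [hl]
  · rw [ev_prod, Finset.prod_eq_zero_iff]
    simp [hlz]

end Triple

namespace GCConf

variable {X : Finset (ℝ × ℝ)} {g : ℝ × ℝ → Fin 5 → Set (ℝ × ℝ)} {K : Fin 3 → Set (ℝ × ℝ)}

lemma card_offLines (h : GCConf X g) (hK : Triple X K) : (offLines X K).card = 6 := by
  have := Triple.card_on_add_off X K
  rw [hK.card_onLines, h.card] at this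
  omega

lemma usesLine_of_mem_off (h : GCConf X g) (hK : Triple X K) {y : ℝ × ℝ} (hy : y ∈ offLines X K)
    (i : Fin 3) : UsesLine g y (K i) := by
  classical
  have h6 := h.card_offLines hK
  obtain ⟨c, hc0, hc, hcz⟩ := exists_vanishing (n := 2) ((offLines X K).erase y) (by
    rw [Finset.card_erase_of_mem hy, h6]; decide)
  obtain ⟨p, hp0, hp, hpz⟩ := hK.exists_cubic
  refine h.usesLine_of_poly (mem_offLines.mp hy).1 (mul_ne_zero hp0 hc0)
    ((totalDegree_mul _ _).trans (by omega)) (fun P hP hPy => ?_) (hK.line i) (fun P hP => ?_)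
  · rw [ev_mul]
    by_cases hPK : ∃ i, P ∈ K i
    · rw [(hpz P).mpr hPK, zero_mul]
    · rw [hcz P (Finset.mem_erase.mpr ⟨hPy, mem_offLines.mpr ⟨hP, not_exists.mp hPK⟩⟩), mul_zero]
  · rw [ev_mul, (hpz P).mpr ⟨i, hP⟩, zero_mul]

/-- The node with lines of four nodes lies on every triple. -/
lemma fourNode_mem_on (h : GCConf X g) {A : ℝ × ℝ} (hA : FourNode X g A) (hK : Triple X K) :
    A ∈ onLines X K := by
  by_contra hno
  have hoff : A ∈ offLines X K := by
    rw [mem_onLines, not_and, not_exists] at hno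
    exact mem_offLines.mpr ⟨hA.mem, hno hA.mem⟩
  obtain ⟨j, hj⟩ := h.usesLine_of_mem_off hK hoff 0
  have h4 := hA.card j
  have h5 := hK.card 0
  rw [hj] at h4
  omega

lemma not_six_lines (h : GCConf X g) (hK : Triple X K) {y : ℝ × ℝ} (hy : y ∈ offLines X K)
    {f : Fin 3 → Set (ℝ × ℝ)} (hf : Function.Injective f) (hfK : ∀ i j, K i ≠ f j)
    (hu : ∀ j, UsesLine g y (f j)) : False := by
  choose a ha using h.usesLine_of_mem_off hK hy
  choose b hb using hu
  have hinj : Function.Injective (Sum.elim a b) := by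
    rintro (i | i) (j | j) hij <;> simp only [Sum.elim_inl, Sum.elim_inr] at hij
    · rw [hK.injective ((ha i).symm.trans (hij ▸ ha j))]
    · exact absurd ((ha i).symm.trans (hij ▸ hb j)) (hfK i j)
    · exact absurd ((ha j).symm.trans (hij ▸ hb i)) (hfK j i)
    · rw [hf ((hb i).symm.trans (hij ▸ hb j))]
  simpa using Fintype.card_le_of_injective _ hinj

lemma exists_three (h : GCConf X g) (hK : Triple X K) {y : ℝ × ℝ} (hy : y ∈ offLines X K) :
    ∃ w, UsesLine g y w ∧ 3 ≤ (nds (offLines X K) w).card := by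
  classical
  choose a ha using h.usesLine_of_mem_off hK hy
  have hainj : Function.Injective a := fun i j hij =>
    hK.injective ((ha i).symm.trans (hij ▸ ha j))
  have hc : (Finset.univ.image a)ᶜ.card = 2 := by
    rw [Finset.card_compl, Finset.card_image_of_injective _ hainj]; simp
  obtain ⟨j₁, j₂, -, hj⟩ := Finset.card_eq_two.mp hc
  have hcov : (offLines X K).erase y ⊆
      nds (offLines X K) (g y j₁) ∪ nds (offLines X K) (g y j₂) := by
    intro P hP
    rw [Finset.mem_erase] at hP
    have hPX := mem_offLines.mp hP.2
    obtain ⟨i, hi⟩ := h.cover y (mem_offLines.mp hy).1 P hPX.1 hP.1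
    have hij : i ∈ (Finset.univ.image a)ᶜ := by
      simp only [Finset.mem_compl, Finset.mem_image, Finset.mem_univ, true_and, not_exists]
      rintro k rfl
      rw [ha k] at hi
      exact hPX.2 k hi
    rw [hj, Finset.mem_insert, Finset.mem_singleton] at hij
    rw [Finset.mem_union, mem_nds, mem_nds]
    rcases hij with rfl | rfl
    · exact Or.inl ⟨hP.2, hi⟩
    · exact Or.inr ⟨hP.2, hi⟩
  have hle := (Finset.card_le_card hcov).trans (Finset.card_union_le _ _)
  rw [Finset.card_erase_of_mem hy, h.card_offLines hK] at hle
  by_cases h3 : 3 ≤ (nds (offLines X K) (g y j₁)).card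
  · exact ⟨_, ⟨_, rfl⟩, h3⟩
  · exact ⟨_, ⟨j₂, rfl⟩, by omega⟩

/-- If more nodes of a line `m` have to be covered than there are lines available, then `m` is one
of the used lines. -/
lemma exists_index_of_card (h : GCConf X g) {D : ℝ × ℝ} (hD : D ∈ X) {m : Set (ℝ × ℝ)}
    (hm : IsLine m) {S : Finset (ℝ × ℝ)} (hS : S ⊆ X) (hSm : ∀ P ∈ S, P ∈ m) (hSD : D ∉ S)
    {J : Finset (Fin 5)} (hJ : ∀ P ∈ S, ∀ j ∈ J, P ∉ g D j) (hc : 5 < S.card + J.card) :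
    ∃ j, j ∉ J ∧ g D j = m := by
  classical
  have hidx : ∀ P ∈ S, ∃ j, P ∈ g D j := fun P hP =>
    h.cover D hD P (hS hP) (by rintro rfl; exact hSD hP)
  choose! k hk using hidx
  obtain ⟨P, hP, Q, hQ, hPQ, hkk⟩ := Finset.exists_ne_map_eq_of_card_lt_of_maps_to
    (s := S) (t := Jᶜ) (f := k) (by
      have hJ5 : J.card ≤ 5 := by simpa using Finset.card_le_univ J
      rw [Finset.card_compl, Fintype.card_fin]
      omega) (by
      intro P hP
      rw [Finset.mem_coe, Finset.mem_compl]
      exact fun hj => hJ P hP _ hj (hk P hP))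
  refine ⟨k P, fun hj => hJ P hP _ hj (hk P hP), ?_⟩
  exact (h.line D hD _).eq_of_two hm hPQ (hk P hP) (hkk ▸ hk Q hQ) (hSm P hP) (hSm Q hQ)

lemma not_usesLine_of_mem_on (h : GCConf X g) (hK : Triple X K) {D : ℝ × ℝ}
    (hD : D ∈ onLines X K) (i : Fin 3) : ¬ UsesLine g D (K i) := by
  classical
  rintro ⟨i₀, hi₀⟩
  obtain ⟨hDX, a, ha⟩ := mem_onLines.mp hD
  have hai : a ≠ i := by rintro rfl; exact h.notMem D hDX i₀ (hi₀ ▸ ha)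
  obtain ⟨c, hca, hci⟩ : ∃ c : Fin 3, c ≠ a ∧ c ≠ i := by
    clear hi₀ ha hai; revert a i; decide
  obtain ⟨i₁, hi₁, hi₁c⟩ := h.exists_index_of_card hDX (hK.line c) (S := nds X (K c)) (J := {i₀})
    (Finset.filter_subset _ _) (fun P hP => (mem_nds.mp hP).2)
    (fun hDc => hK.disj a c hca.symm D hDX ha (mem_nds.mp hDc).2)
    (fun P hP j hj => by
      rw [Finset.mem_singleton] at hj
      rw [hj, hi₀]
      exact hK.disj c i hci P (mem_nds.mp hP).1 (mem_nds.mp hP).2)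
    (by rw [hK.card c]; simp)
  rw [Finset.mem_singleton] at hi₁
  obtain ⟨j, -, hj⟩ := h.exists_index_of_card hDX (hK.line a) (S := (nds X (K a)).erase D)
    (J := {i₀, i₁}) ((Finset.erase_subset _ _).trans (Finset.filter_subset _ _))
    (fun P hP => (mem_nds.mp (Finset.mem_of_mem_erase hP)).2) (Finset.notMem_erase _ _)
    (fun P hP j hj => by
      have hP := mem_nds.mp (Finset.mem_of_mem_erase hP)
      rw [Finset.mem_insert, Finset.mem_singleton] at hj
      rcases hj with rfl | rfl
      · rw [hi₀]; exact hK.disj a i hai P hP.1 hP.2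
      · rw [hi₁c]; exact hK.disj a c hca.symm P hP.1 hP.2)
    (by rw [Finset.card_erase_of_mem (mem_nds.mpr ⟨hDX, ha⟩), hK.card a,
          Finset.card_pair (Ne.symm hi₁)]
        norm_num)
  exact h.notMem D hDX j (hj ▸ ha)

lemma exists_mem_of_usesLine (h : GCConf X g) (hK : Triple X K) {D : ℝ × ℝ} (hD : D ∈ X)
    {i : Fin 3} (hDi : D ∈ K i) {f : Set (ℝ × ℝ)} (hu : UsesLine g D f) {j : Fin 3} (hij : j ≠ i) :
    ∃ P ∈ X, P ∈ K j ∧ P ∈ f := by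
  classical
  by_contra! hno
  obtain ⟨i₀, hi₀⟩ := hu
  obtain ⟨k, -, hk⟩ := h.exists_index_of_card hD (hK.line j) (S := nds X (K j)) (J := {i₀})
    (Finset.filter_subset _ _) (fun P hP => (mem_nds.mp hP).2)
    (fun hDj => hK.disj i j hij.symm D hD hDi (mem_nds.mp hDj).2)
    (fun P hP j hj => by
      rw [Finset.mem_singleton] at hj
      rw [hj, hi₀]
      exact hno P (mem_nds.mp hP).1 (mem_nds.mp hP).2)
    (by rw [hK.card j]; simp)
  exact h.not_usesLine_of_mem_on hK (mem_onLines.mpr ⟨hD, i, hDi⟩) j ⟨k, hk⟩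

lemma exists_poly_two_lines (hK : Triple X K) {f w : Set (ℝ × ℝ)} (hf : IsLine f) (hw : IsLine w) :
    ∃ p : MvPolynomial (Fin 2) ℝ, p ≠ 0 ∧ p.totalDegree ≤ 5 ∧
      ∀ P, ev p P = 0 ↔ (∃ i, P ∈ K i) ∨ P ∈ f ∨ P ∈ w := by
  obtain ⟨p, hp0, hp, hpz⟩ := hK.exists_cubic
  obtain ⟨l, hl0, hl, hlz⟩ := hf.ne_zero_poly
  obtain ⟨m, hm0, hm, hmz⟩ := hw.ne_zero_poly
  refine ⟨p * (l * m), mul_ne_zero hp0 (mul_ne_zero hl0 hm0), ?_, fun P => ?_⟩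
  · have h1 := totalDegree_mul p (l * m)
    have h2 := totalDegree_mul l m
    omega
  · rw [ev_mul, ev_mul, mul_eq_zero, mul_eq_zero, hpz, hlz, hmz]

/-- A line with two nodes off the triple is used by a node off the triple as soon as three of the
remaining four nodes off the triple are collinear. -/
lemma exists_user_of_three (h : GCConf X g) (hK : Triple X K) {f w : Set (ℝ × ℝ)}
    (hf : IsLine f) (hw : IsLine w) (hfY : (nds (offLines X K) f).card = 2)
    (hwY : 3 ≤ (nds (offLines X K) w).card)
    (hfw : ∀ P ∈ offLines X K, P ∈ f → P ∉ w) : ∃ B ∈ offLines X K, UsesLine g B f := by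
  classical
  obtain ⟨p, hp0, hp, hpz⟩ := exists_poly_two_lines hK hf hw
  set R := (offLines X K).filter (fun P => P ∉ f ∧ P ∉ w) with hR
  have hRc : R.card ≤ 1 := by
    have hd : Disjoint (nds (offLines X K) f) (nds (offLines X K) w) := by
      rw [Finset.disjoint_left]
      exact fun P hP hP' => hfw P (mem_nds.mp hP).1 (mem_nds.mp hP).2 (mem_nds.mp hP').2
    have hd2 : Disjoint (nds (offLines X K) f ∪ nds (offLines X K) w) R := by
      rw [Finset.disjoint_left]
      intro P hP hP'
      rw [Finset.mem_union, mem_nds, mem_nds] at hP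
      rw [hR, Finset.mem_filter] at hP'
      tauto
    have hsub : (nds (offLines X K) f ∪ nds (offLines X K) w) ∪ R ⊆ offLines X K :=
      Finset.union_subset (Finset.union_subset (Finset.filter_subset _ _)
        (Finset.filter_subset _ _)) (Finset.filter_subset _ _)
    have := Finset.card_le_card hsub
    rw [Finset.card_union_of_disjoint hd2, Finset.card_union_of_disjoint hd,
      h.card_offLines hK] at this
    omega
  obtain ⟨B, hB, hBR⟩ : ∃ B ∈ offLines X K, ∀ P ∈ R, P = B := by
    rcases R.eq_empty_or_nonempty with he | ⟨B, hB⟩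
    · obtain ⟨B, hB⟩ : (offLines X K).Nonempty := by
        rw [← Finset.card_pos, h.card_offLines hK]; norm_num
      exact ⟨B, hB, by simp [he]⟩
    · exact ⟨B, (Finset.mem_filter.mp hB).1, fun P hP => Finset.card_le_one.mp hRc P hP B hB⟩
  refine ⟨B, hB, h.usesLine_of_poly (mem_offLines.mp hB).1 hp0 hp (fun P hP hPB => ?_) hf
    fun P hP => (hpz P).mpr (Or.inr (Or.inl hP))⟩
  rw [hpz]
  by_contra! hno
  exact hPB (hBR P (Finset.mem_filter.mpr ⟨mem_offLines.mpr ⟨hP, hno.1⟩, hno.2⟩))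

lemma exists_user_of_two_lines (h : GCConf X g) (hK : Triple X K) {f f' : Set (ℝ × ℝ)}
    (hf : IsLine f) (hf' : IsLine f') (hne : f ≠ f') {z : ℝ × ℝ} (hz : z ∈ offLines X K)
    (hzf : z ∈ f) (hzf' : z ∈ f') (hfY : (nds (offLines X K) f).card = 2)
    (hfY' : (nds (offLines X K) f').card = 2) :
    ∃ B ∈ offLines X K, UsesLine g B f ∨ UsesLine g B f' := by
  classical
  by_contra! hno
  have hXY : ∀ P ∈ offLines X K, P ∈ X := fun P hP => (mem_offLines.mp hP).1
  have key : ∀ f, IsLine f → (nds (offLines X K) f).card = 2 → z ∈ f →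
      (∀ B ∈ offLines X K, ¬ UsesLine g B f) → ∃ y ∈ offLines X K, y ≠ z ∧ y ∈ f ∧
      ∀ w, IsLine w → 3 ≤ (nds (offLines X K) w).card → (z ∉ w ↔ y ∈ w) := by
    intro f hf hfY hzf hnu
    have hzm : z ∈ nds (offLines X K) f := mem_nds.mpr ⟨hz, hzf⟩
    obtain ⟨y, hy⟩ := Finset.card_eq_one.mp
      ((Finset.card_erase_of_mem hzm).trans (by rw [hfY]))
    have hy' : y ∈ (nds (offLines X K) f).erase z := by rw [hy]; simp
    rw [Finset.mem_erase, mem_nds] at hy'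
    refine ⟨y, hy'.2.1, hy'.1, hy'.2.2, fun w hw hwY => ⟨fun hzw => ?_, fun hyw hzw => ?_⟩⟩
    · by_contra hyw
      obtain ⟨B, hB, hBf⟩ := h.exists_user_of_three hK hf hw hfY hwY (fun P hP hPf => by
        by_cases hPz : P = z
        · rw [hPz]; exact hzw
        · have : P ∈ (nds (offLines X K) f).erase z :=
            Finset.mem_erase.mpr ⟨hPz, mem_nds.mpr ⟨hP, hPf⟩⟩
          rw [hy, Finset.mem_singleton] at this
          rw [this]; exact hyw)
      exact hnu B hB hBf
    · have := hw.eq_of_two hf hy'.1 hyw hzw hy'.2.2 hzf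
      rw [this, hfY] at hwY
      omega
  obtain ⟨y, hy, hyz, hyf, hyw⟩ := key f hf hfY hzf fun B hB => (hno B hB).1
  obtain ⟨y', hy', hyz', hyf', hyw'⟩ := key f' hf' hfY' hzf' fun B hB => (hno B hB).2
  have hyy : y ≠ y' := by
    rintro rfl
    exact hne (hf.eq_of_two hf' hyz hyf hzf hyf' hzf')
  obtain ⟨w, hwu, hw3⟩ := h.exists_three hK hz
  have hwl := h.usesLine_line (hXY z hz) hwu
  have hzw := h.usesLine_notMem (hXY z hz) hwu
  have hyw1 := (hyw w hwl hw3).mp hzw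
  have hyw1' := (hyw' w hwl hw3).mp hzw
  obtain ⟨v, hv, hvy⟩ := Finset.exists_mem_notMem_of_card_lt_card
    (s := {y, y'}) (t := nds (offLines X K) w) (by rw [Finset.card_pair hyy]; omega)
  rw [mem_nds] at hv
  simp only [Finset.mem_insert, Finset.mem_singleton, not_or] at hvy
  obtain ⟨w', hwu', hw3'⟩ := h.exists_three hK hv.1
  have hwl' := h.usesLine_line (hXY v hv.1) hwu'
  have hvw' := h.usesLine_notMem (hXY v hv.1) hwu'
  by_cases hzw' : z ∈ w'
  · have hn1 : y ∉ w' := fun hh => (hyw w' hwl' hw3').mpr hh hzw'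
    have hn2 : y' ∉ w' := fun hh => (hyw' w' hwl' hw3').mpr hh hzw'
    obtain ⟨p, hp0, hp, hpz⟩ := exists_poly_two_lines hK hwl hwl'
    have hc3 : ({y, y', v} : Finset (ℝ × ℝ)).card = 3 := by
      rw [Finset.card_eq_three]
      exact ⟨y, y', v, hyy, Ne.symm hvy.1, Ne.symm hvy.2, rfl⟩
    have hd : Disjoint ({y, y', v} : Finset (ℝ × ℝ)) (nds (offLines X K) w') := by
      rw [Finset.disjoint_left]
      intro P hP hP'
      simp only [Finset.mem_insert, Finset.mem_singleton] at hP
      rw [mem_nds] at hP'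
      rcases hP with rfl | rfl | rfl <;> tauto
    have hsub : ({y, y', v} : Finset (ℝ × ℝ)) ∪ nds (offLines X K) w' ⊆ offLines X K := by
      refine Finset.union_subset ?_ (Finset.filter_subset _ _)
      intro P hP
      simp only [Finset.mem_insert, Finset.mem_singleton] at hP
      rcases hP with rfl | rfl | rfl <;> tauto
    have heq := Finset.eq_of_subset_of_card_le hsub (by
      rw [Finset.card_union_of_disjoint hd, hc3, h.card_offLines hK]; omega)
    refine hp0 (h.poised p hp fun P hP => (hpz P).mpr ?_)
    by_cases hPK : ∃ i, P ∈ K i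
    · exact Or.inl hPK
    · have hPY : P ∈ offLines X K := mem_offLines.mpr ⟨hP, not_exists.mp hPK⟩
      rw [← heq, Finset.mem_union, mem_nds] at hPY
      simp only [Finset.mem_insert, Finset.mem_singleton] at hPY
      rcases hPY with (rfl | rfl | rfl) | hPY <;> tauto
  · have e := hwl.eq_of_two hwl' hyy hyw1 hyw1' ((hyw w' hwl' hw3').mp hzw')
      ((hyw' w' hwl' hw3').mp hzw')
    exact hvw' (e ▸ hv.2)

end GCConf

end Triples

section Special

namespace GCConf

variable {X : Finset (ℝ × ℝ)} {g : ℝ × ℝ → Fin 5 → Set (ℝ × ℝ)} {K : Fin 3 → Set (ℝ × ℝ)}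

lemma exists_quartic_of_usesLine (h : GCConf X g) {D : ℝ × ℝ} (hD : D ∈ X) {f : Set (ℝ × ℝ)}
    (hu : UsesLine g D f) : ∃ q : MvPolynomial (Fin 2) ℝ, q.totalDegree ≤ 4 ∧ ev q D ≠ 0 ∧
      (∀ P ∈ X, P ≠ D → P ∉ f → ev q P = 0) ∧ ∀ P, ev q P = 0 → ∃ i, P ∈ g D i := by
  obtain ⟨i₀, hi₀⟩ := hu
  obtain ⟨q, hq, hqz⟩ := h.exists_quartic hD i₀
  refine ⟨q, hq, ?_, fun P hP hPD hPf => ?_, fun P hP => ?_⟩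
  · rw [Ne, hqz]
    rintro ⟨i, -, hi⟩
    exact h.notMem D hD i hi
  · obtain ⟨i, hi⟩ := h.cover D hD P hP hPD
    exact (hqz P).mpr ⟨i, by rintro rfl; exact hPf (hi₀ ▸ hi), hi⟩
  · obtain ⟨i, -, hi⟩ := (hqz P).mp hP
    exact ⟨i, hi⟩

lemma exists_extra_point (h : GCConf X g) (hK : Triple X K) {D D' : ℝ × ℝ}
    (hD : D ∈ onLines X K) (hD' : D' ∈ onLines X K) (k : Fin 3) :
    ∃ E ∈ K k, E ∉ X ∧ (∀ i, E ∉ g D i) ∧ ∀ i, E ∉ g D' i := by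
  have key : ∀ {D}, D ∈ onLines X K → (⋃ i, K k ∩ g D i).Finite := by
    intro D hD
    refine Set.finite_iUnion fun i => Set.Subsingleton.finite fun P hP Q hQ => ?_
    by_contra hne
    exact h.not_usesLine_of_mem_on hK hD k ⟨i, (h.line D (mem_onLines.mp hD).1 i).eq_of_two
      (hK.line k) hne hP.2 hQ.2 hP.1 hQ.1⟩
  obtain ⟨E, hE, hES⟩ := (hK.line k).exists_mem_notMem
    (S := ↑X ∪ ((⋃ i, K k ∩ g D i) ∪ ⋃ i, K k ∩ g D' i))
    (X.finite_toSet.union ((key hD).union (key hD')))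
  simp only [Set.mem_union, Finset.mem_coe, Set.mem_iUnion, Set.mem_inter_iff, hE, true_and,
    not_or, not_exists] at hES
  exact ⟨E, hE, hES⟩

open scoped Classical in
/-- A line missing the nodes of one line of a triple is used by at most one node of the triple. -/
lemma eq_of_usesLine_special (h : GCConf X g) (hK : Triple X K) {m : Fin 3} {f : Set (ℝ × ℝ)}
    (hm : ∀ P ∈ X, P ∈ K m → P ∉ f) {D D' : ℝ × ℝ} (hD : D ∈ onLines X K)
    (hD' : D' ∈ onLines X K) (hu : UsesLine g D f) (hu' : UsesLine g D' f) : D = D' := by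
  by_contra hne
  have hmem : ∀ {D}, D ∈ onLines X K → UsesLine g D f → D ∈ X ∧ D ∈ K m := by
    intro D hD hu
    obtain ⟨hDX, i, hi⟩ := mem_onLines.mp hD
    refine ⟨hDX, ?_⟩
    by_contra hDm
    obtain ⟨P, hP, hPm, hPf⟩ := h.exists_mem_of_usesLine hK hDX hi hu
      (j := m) (by rintro rfl; exact hDm hi)
    exact hm P hP hPm hPf
  obtain ⟨hDX, hDm⟩ := hmem hD hu
  obtain ⟨hDX', hDm'⟩ := hmem hD' hu'
  have hf := h.usesLine_line hDX hu
  obtain ⟨a, b, ham, hbm, hab⟩ : ∃ a b : Fin 3, a ≠ m ∧ b ≠ m ∧ a ≠ b := by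
    clear hm hmem hDm hDm'; revert m; decide
  obtain ⟨q, hq, hqD, hqz, hqi⟩ := h.exists_quartic_of_usesLine hDX hu
  obtain ⟨q', hq', hqD', hqz', hqi'⟩ := h.exists_quartic_of_usesLine hDX' hu'
  obtain ⟨E, hEa, hEX, hED, hED'⟩ := h.exists_extra_point hK hD hD' a
  have hE' : ev q' E ≠ 0 := fun h0 => (hqi' E h0).elim hED'
  set t := ev q E / ev q' E with ht
  set r := q - C t * q' with hr
  have hrd : r.totalDegree ≤ 4 := by
    refine (totalDegree_sub _ _).trans (max_le hq ((totalDegree_mul _ _).trans ?_))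
    rw [totalDegree_C]; omega
  have hrev : ∀ P, ev r P = ev q P - t * ev q' P := fun P => by
    rw [hr, ev_sub, ev_mul, ev_C]
  have hrz : ∀ P ∈ X, P ≠ D → P ≠ D' → P ∉ f → ev r P = 0 := fun P hP h1 h2 h3 => by
    rw [hrev, hqz P hP h1 h3, hqz' P hP h2 h3]; ring
  have hrE : ev r E = 0 := by
    rw [hrev, ht, div_mul_cancel₀ _ hE', sub_self]
  have hrc : ∀ k, 4 ≤ ((nds X (K k)).filter (· ∉ f)).card := by
    intro k
    have h1 := (hK.line k).card_nds_le_one hf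
      (by rintro rfl; exact h.not_usesLine_of_mem_on hK hD k hu) X
    have h2 : (nds (nds X (K k)) f).card + ((nds X (K k)).filter (· ∉ f)).card = 5 := by
      rw [← hK.card k]
      exact Finset.card_filter_add_card_filter_not _
    omega
  have hrk : ∀ k, k ≠ m → ∀ P ∈ (nds X (K k)).filter (· ∉ f), P ∈ X ∧ P ∈ K k ∧ ev r P = 0 := by
    intro k hk P hP
    rw [Finset.mem_filter, mem_nds] at hP
    have hPm : P ∉ K m := hK.disj k m hk P hP.1.1 hP.1.2
    exact ⟨hP.1.1, hP.1.2, hrz P hP.1.1 (by rintro rfl; exact hPm hDm)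
      (by rintro rfl; exact hPm hDm') hP.2⟩
  obtain ⟨la, hla, hlaK⟩ := hK.line a
  obtain ⟨lb, hlb, hlbK⟩ := hK.line b
  obtain ⟨lm, hlm, hlmK⟩ := hK.line m
  have hza : ∀ P, ev la P = 0 ↔ P ∈ K a := fun P => by rw [← hlaK]; rfl
  have hzb : ∀ P, ev lb P = 0 ↔ P ∈ K b := fun P => by rw [← hlbK]; rfl
  have hzm : ∀ P, ev lm P = 0 ↔ P ∈ K m := fun P => by rw [← hlmK]; rfl
  obtain ⟨r₁, hr₁, hrr₁⟩ := hla.exists_eq_mul hrd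
    (S := insert E ((nds X (K a)).filter (· ∉ f))) (fun P hP => by
      rw [Finset.mem_insert] at hP
      rcases hP with rfl | hP
      · exact ⟨(hza P).mpr hEa, hrE⟩
      · have := hrk a ham P hP
        exact ⟨(hza P).mpr this.2.1, this.2.2⟩) (by
    rw [Finset.card_insert_of_notMem (fun hE => hEX (hrk a ham E hE).1)]
    have := hrc a
    omega)
  obtain ⟨r₂, hr₂, hrr₂⟩ := hlb.exists_eq_mul hr₁ (S := (nds X (K b)).filter (· ∉ f))
    (fun P hP => by
      obtain ⟨h1, h2, h3⟩ := hrk b hbm P hP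
      refine ⟨(hzb P).mpr h2, ?_⟩
      rw [hrr₁, ev_mul, mul_eq_zero, hza] at h3
      exact h3.resolve_left (hK.disj b a hab.symm P h1 h2)) (by have := hrc b; omega)
  obtain ⟨r₃, hr₃, hrr₃⟩ := hlm.exists_eq_mul hr₂ (S := ((nds X (K m)).erase D).erase D')
    (fun P hP => by
      rw [Finset.mem_erase, Finset.mem_erase, mem_nds] at hP
      obtain ⟨h1, h2, h3, h4⟩ := hP
      refine ⟨(hzm P).mpr h4, ?_⟩
      have h5 := hrz P h3 h2 h1 (hm P h3 h4)
      rw [hrr₁, hrr₂, ev_mul, ev_mul, mul_eq_zero, mul_eq_zero, hza, hzb] at h5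
      exact (h5.resolve_left (hK.disj m a ham.symm P h3 h4)).resolve_left
        (hK.disj m b hbm.symm P h3 h4)) (by
    rw [Finset.card_erase_of_mem, Finset.card_erase_of_mem (mem_nds.mpr ⟨hDX, hDm⟩), hK.card m]
    · norm_num
    · exact Finset.mem_erase.mpr ⟨Ne.symm hne, mem_nds.mpr ⟨hDX', hDm'⟩⟩)
  have h0 : ev r D = 0 := by
    rw [hrr₁, hrr₂, hrr₃, ev_mul, ev_mul, ev_mul, (hzm D).mpr hDm]
    ring
  rw [hrev, hqz' D hDX hne (hm D hDX hDm), mul_zero, sub_zero] at h0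
  exact hqD h0

end GCConf

end Special

section TwoTriples

variable {X : Finset (ℝ × ℝ)} {g : ℝ × ℝ → Fin 5 → Set (ℝ × ℝ)} {K K' : Fin 3 → Set (ℝ × ℝ)}
  {f : Set (ℝ × ℝ)}

lemma nds_onLines (S : Finset (ℝ × ℝ)) (K : Fin 3 → Set (ℝ × ℝ)) (f : Set (ℝ × ℝ)) :
    nds (onLines S K) f = onLines (nds S f) K := by
  ext P; simp only [mem_nds, mem_onLines]; tauto

lemma nds_offLines (S : Finset (ℝ × ℝ)) (K : Fin 3 → Set (ℝ × ℝ)) (f : Set (ℝ × ℝ)) :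
    nds (offLines S K) f = offLines (nds S f) K := by
  ext P; simp only [mem_nds, mem_offLines]; tauto

lemma card_nds_on_add_off (S : Finset (ℝ × ℝ)) (K : Fin 3 → Set (ℝ × ℝ)) (f : Set (ℝ × ℝ)) :
    (nds (onLines S K) f).card + (nds (offLines S K) f).card = (nds S f).card := by
  rw [nds_onLines, nds_offLines, Triple.card_on_add_off]

/-- The line `f` meets each line of `K` in a node. -/
def Meets (X : Finset (ℝ × ℝ)) (K : Fin 3 → Set (ℝ × ℝ)) (f : Set (ℝ × ℝ)) : Prop :=
  ∀ i, ∃ P ∈ X, P ∈ K i ∧ P ∈ f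

namespace Triple

lemma card_nds_on (hK : Triple X K) (f : Set (ℝ × ℝ)) :
    (nds (onLines X K) f).card = ∑ i, (nds (nds X f) (K i)).card := by
  classical
  rw [nds_onLines, hK.card_on (S := nds X f) (Finset.filter_subset _ _)]

lemma card_nds_on_le (hK : Triple X K) (hf : IsLine f) (hfK : ∀ i, K i ≠ f) :
    (nds (onLines X K) f).card ≤ 3 := by
  rw [hK.card_nds_on]
  refine (Finset.sum_le_card_nsmul _ _ 1 fun i _ =>
    hf.card_nds_le_one (hK.line i) (hfK i).symm X).trans ?_
  simp

lemma card_nds_on_eq (hK : Triple X K) (hf : IsLine f) (hfK : ∀ i, K i ≠ f)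
    (hr : Meets X K f) : (nds (onLines X K) f).card = 3 := by
  rw [hK.card_nds_on, Finset.sum_congr rfl (g := fun _ => 1)]
  · simp
  · intro i _
    refine le_antisymm (hf.card_nds_le_one (hK.line i) (hfK i).symm X) (Finset.card_pos.mpr ?_)
    obtain ⟨P, hP, hPi, hPf⟩ := hr i
    exact ⟨P, mem_nds.mpr ⟨mem_nds.mpr ⟨hP, hPf⟩, hPi⟩⟩

lemma ne_of_meets (hK' : Triple X K') (hK0 : ∀ i, K i ≠ K' 0) (hr : Meets X K (K' 0)) :
    ∀ i j, K i ≠ K' j := by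
  rintro i j hij
  obtain ⟨P, hP, hPi, hP0⟩ := hr i
  by_cases hj : j = 0
  · exact hK0 i (hj ▸ hij)
  · exact hK'.disj 0 j (Ne.symm hj) P hP hP0 (hij ▸ hPi)

end Triple

namespace GCConf

lemma two_le_card_nds_on (h : GCConf X g) (hK : Triple X K) {D : ℝ × ℝ} (hD : D ∈ onLines X K)
    (hu : UsesLine g D f) : 2 ≤ (nds (onLines X K) f).card := by
  obtain ⟨hDX, i, hi⟩ := mem_onLines.mp hD
  obtain ⟨a, b, hai, hbi, hab⟩ : ∃ a b : Fin 3, a ≠ i ∧ b ≠ i ∧ a ≠ b := by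
    clear hi; revert i; decide
  obtain ⟨P, hP, hPa, hPf⟩ := h.exists_mem_of_usesLine hK hDX hi hu hai
  obtain ⟨Q, hQ, hQb, hQf⟩ := h.exists_mem_of_usesLine hK hDX hi hu hbi
  refine Finset.one_lt_card.mpr ⟨P, mem_nds.mpr ⟨mem_onLines.mpr ⟨hP, a, hPa⟩, hPf⟩,
    Q, mem_nds.mpr ⟨mem_onLines.mpr ⟨hQ, b, hQb⟩, hQf⟩, ?_⟩
  rintro rfl
  exact hK.disj a b hab P hP hPa hQb

lemma meets_of_two (h : GCConf X g) (hK : Triple X K) {S : Finset (ℝ × ℝ)} (hS : 2 ≤ S.card)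
    (hSu : ∀ D ∈ S, D ∈ onLines X K ∧ UsesLine g D f) : Meets X K f := by
  by_contra hno
  simp only [Meets, not_forall, not_exists, not_and] at hno
  obtain ⟨m, hm⟩ := hno
  obtain ⟨D, hD, D', hD', hne⟩ := Finset.one_lt_card.mp hS
  exact hne (h.eq_of_usesLine_special hK hm (hSu D hD).1 (hSu D' hD').1 (hSu D hD).2 (hSu D' hD').2)

/-- If a node off the triple uses a further line of five nodes which meets the lines of the triple
in nodes, then that line has few users. -/
lemma users_le_four (h : GCConf X g) (hK : Triple X K) (hf5 : (nds X f).card = 5)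
    (hfK : ∀ i, K i ≠ f) (hr : Meets X K f) {B : ℝ × ℝ} (hB : B ∈ offLines X K)
    (hu : UsesLine g B f) : (users X g f).card ≤ 4 := by
  rcases h.users_five (mem_users.mpr ⟨(mem_offLines.mp hB).1, hu⟩) hf5 with
    h4 | ⟨l₁, l₂, u₁, u₂, hT⟩
  · exact h4
  · refine (h.not_six_lines hK hB hT.injective (hT.ne_of_meets hfK hr) fun j => ?_).elim
    fin_cases j <;> assumption

lemma mem_on_of_mem_off (h : GCConf X g) (hK : Triple X K) (hK' : Triple X K')
    (hne : ∀ i j, K i ≠ K' j) {y : ℝ × ℝ} (hy : y ∈ offLines X K) : y ∈ onLines X K' := by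
  have hyX := (mem_offLines.mp hy).1
  by_contra hno
  rw [mem_onLines, not_and, not_exists] at hno
  exact h.not_six_lines hK hy hK'.injective hne fun j =>
    h.usesLine_of_mem_off hK' (mem_offLines.mpr ⟨hyX, hno hyX⟩) j

lemma card_nds_off_eq_two (h : GCConf X g) (hK : Triple X K) (hK' : Triple X K')
    (hne : ∀ i j, K i ≠ K' j) (j : Fin 3) : (nds (offLines X K) (K' j)).card = 2 := by
  classical
  have hge : ∀ j, 2 ≤ (nds (offLines X K) (K' j)).card := by
    intro j
    have h1 := card_nds_on_add_off X K (K' j)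
    have h2 := hK.card_nds_on_le (hK'.line j) (fun i => hne i j)
    have h3 := hK'.card j
    omega
  have hsum := hK'.card_on (S := offLines X K) (Finset.filter_subset _ _)
  have hall : onLines (offLines X K) K' = offLines X K := by
    refine Finset.Subset.antisymm (Finset.filter_subset _ _) fun y hy => ?_
    exact mem_onLines.mpr ⟨hy, (mem_onLines.mp (h.mem_on_of_mem_off hK hK' hne hy)).2⟩
  rw [hall, h.card_offLines hK, Fin.sum_univ_three] at hsum
  have h0 := hge 0
  have h1 := hge 1
  have h2 := hge 2
  fin_cases j <;> simp <;> omega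

lemma exists_off_user (h : GCConf X g) (hK : Triple X K) (hK' : Triple X K')
    (hne : ∀ i j, K i ≠ K' j) (hf : IsLine f) (hf5 : (nds X f).card = 5) (hfK : ∀ i, K i ≠ f)
    (hfK' : ∀ i, K' i ≠ f) (hr : Meets X K f) : ∃ B ∈ offLines X K, UsesLine g B f := by
  have h2 : (nds (offLines X K) f).card = 2 := by
    have h1 := card_nds_on_add_off X K f
    have h2 := hK.card_nds_on_eq hf hfK hr
    omega
  obtain ⟨z, hz⟩ : (nds (offLines X K) f).Nonempty := by
    rw [← Finset.card_pos, h2]; norm_num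
  rw [mem_nds] at hz
  obtain ⟨j, hj⟩ := (mem_onLines.mp (h.mem_on_of_mem_off hK hK' hne hz.1)).2
  obtain ⟨B, hB, hu | hu⟩ := h.exists_user_of_two_lines hK hf (hK'.line j) (hfK' j).symm hz.1
    hz.2 hj h2 (h.card_nds_off_eq_two hK hK' hne j)
  · exact ⟨B, hB, hu⟩
  · exact (h.not_usesLine_of_mem_on hK' (h.mem_on_of_mem_off hK hK' hne hB) j hu).elim

lemma card_le_two_of_five (h : GCConf X g) (hK : Triple X K) (hK' : Triple X K')
    (hne : ∀ i j, K i ≠ K' j) (hf : IsLine f) (hf5 : (nds X f).card = 5) {S : Finset (ℝ × ℝ)}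
    (hS : ∀ D ∈ S, D ∈ onLines X K ∧ D ∈ onLines X K' ∧ UsesLine g D f) : S.card ≤ 2 := by
  classical
  by_contra! h3
  obtain ⟨D, hD⟩ : S.Nonempty := by rw [← Finset.card_pos]; omega
  have hfK : ∀ i, K i ≠ f := by
    rintro i rfl
    exact h.not_usesLine_of_mem_on hK (hS D hD).1 i (hS D hD).2.2
  have hfK' : ∀ i, K' i ≠ f := by
    rintro i rfl
    exact h.not_usesLine_of_mem_on hK' (hS D hD).2.1 i (hS D hD).2.2
  have hr := h.meets_of_two hK h3.le fun D hD => ⟨(hS D hD).1, (hS D hD).2.2⟩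
  have hr' := h.meets_of_two hK' h3.le fun D hD => (hS D hD).2
  have hne' : ∀ i j, K' i ≠ K j := fun i j => (hne j i).symm
  obtain ⟨B, hB, hu⟩ := h.exists_off_user hK hK' hne hf hf5 hfK hfK' hr
  obtain ⟨B', hB', hu'⟩ := h.exists_off_user hK' hK hne' hf hf5 hfK' hfK hr'
  have h4 := h.users_le_four hK hf5 hfK hr hB hu
  have hBK' := h.mem_on_of_mem_off hK hK' hne hB
  have hoff : ∀ {K P}, P ∈ onLines X K → P ∉ offLines X K := by
    intro K P hP hP'
    obtain ⟨-, i, hi⟩ := mem_onLines.mp hP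
    exact (mem_offLines.mp hP').2 i hi
  have hB'S : B' ∉ S := fun hh => hoff (hS B' hh).2.1 hB'
  have hBS : B ∉ insert B' S := by
    rw [Finset.mem_insert, not_or]
    exact ⟨by rintro rfl; exact hoff hBK' hB', fun hh => hoff (hS B hh).1 hB⟩
  have hsub : insert B (insert B' S) ⊆ users X g f := by
    intro P hP
    rw [Finset.mem_insert, Finset.mem_insert] at hP
    rw [mem_users]
    rcases hP with rfl | rfl | hP
    · exact ⟨(mem_offLines.mp hB).1, hu⟩
    · exact ⟨(mem_offLines.mp hB').1, hu'⟩
    · exact ⟨(mem_onLines.mp (hS P hP).1).1, (hS P hP).2.2⟩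
  have := Finset.card_le_card hsub
  rw [Finset.card_insert_of_notMem hBS, Finset.card_insert_of_notMem hB'S] at this
  omega

lemma card_le_two_of_meets (h : GCConf X g) (hK : Triple X K) (hK' : Triple X K')
    (hne : ∀ i j, K i ≠ K' j) (hf : IsLine f) {z : ℝ × ℝ} (hz : z ∈ offLines X K) (hzf : z ∈ f)
    (hfK : ∀ i, K i ≠ f) (hr : Meets X K f) {S : Finset (ℝ × ℝ)}
    (hS : ∀ D ∈ S, D ∈ onLines X K ∧ D ∈ onLines X K' ∧ UsesLine g D f) : S.card ≤ 2 := by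
  classical
  by_contra! h3
  obtain ⟨D, hD⟩ : S.Nonempty := by rw [← Finset.card_pos]; omega
  have hSX : ∀ D ∈ S, D ∈ X := fun D hD => (mem_onLines.mp (hS D hD).1).1
  have h5 := h.card_le f hf
  have h1 := card_nds_on_add_off X K f
  have h2 := hK.card_nds_on_eq hf hfK hr
  have hpos : 0 < (nds (offLines X K) f).card := Finset.card_pos.mpr ⟨z, mem_nds.mpr ⟨hz, hzf⟩⟩
  have hn5 : (nds X f).card ≠ 5 := fun hf5 => by
    have := h.card_le_two_of_five hK hK' hne hf hf5 hS
    omega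
  obtain ⟨hu3, hu⟩ := h.users_four (mem_users.mpr ⟨hSX D hD, (hS D hD).2.2⟩) (f := f) (by omega)
  have hsub : S ⊆ users X g f := fun P hP => mem_users.mpr ⟨hSX P hP, (hS P hP).2.2⟩
  have hle := Finset.card_le_card hsub
  obtain ⟨l, hlD, hl5, hl⟩ := hu (by omega)
  have hll := h.usesLine_line (hSX D hD) hlD
  have := h.card_le_two_of_five hK hK' hne hll hl5 (S := S) fun P hP => by
    refine ⟨(hS P hP).1, (hS P hP).2.1, ?_⟩
    obtain ⟨i, hi⟩ := (hS P hP).2.2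
    obtain ⟨j, -, hj⟩ := h.exists_index_of_card (hSX P hP) hll (S := nds X l) (J := {i})
      (Finset.filter_subset _ _) (fun Q hQ => (mem_nds.mp hQ).2)
      (fun hPl => (hl P (hSX P hP) (mem_nds.mp hPl).2).2 (hsub hP))
      (fun Q hQ j hj => by
        rw [Finset.mem_singleton] at hj
        rw [hj, hi]
        exact (hl Q (mem_nds.mp hQ).1 (mem_nds.mp hQ).2).1)
      (by rw [hl5]; simp)
    exact ⟨j, hj⟩
  omega

/-- Two triples have a line in common. -/
lemma not_two_triples (h : GCConf X g) (hK : Triple X K) (hK' : Triple X K')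
    (hne : ∀ i j, K i ≠ K' j) : False := by
  classical
  have hne' : ∀ i j, K' i ≠ K j := fun i j => (hne j i).symm
  obtain ⟨z, hz⟩ : (offLines X K).Nonempty := by
    rw [← Finset.card_pos, h.card_offLines hK]; norm_num
  have hzX := mem_offLines.mp hz
  obtain ⟨j, hj⟩ := (mem_onLines.mp (h.mem_on_of_mem_off hK hK' hne hz)).2
  set G := onLines (onLines X K) K' with hG
  have hGc : G.card = 9 := by
    have h1 := Triple.card_on_add_off (onLines X K) K'
    have h2 : offLines (onLines X K) K' = offLines X K' := by
      ext P
      refine ⟨fun hP => ?_, fun hP => ?_⟩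
      · rw [mem_offLines, mem_onLines] at hP
        exact mem_offLines.mpr ⟨hP.1.1, hP.2⟩
      · exact mem_offLines.mpr ⟨h.mem_on_of_mem_off hK' hK hne' hP, (mem_offLines.mp hP).2⟩
    rw [h2, hK.card_onLines, h.card_offLines hK', ← hG] at h1
    omega
  have hGm : ∀ D ∈ G, D ∈ onLines X K ∧ D ∈ onLines X K' := fun D hD => by
    rw [hG, mem_onLines] at hD
    exact ⟨hD.1, mem_onLines.mpr ⟨(mem_onLines.mp hD.1).1, hD.2⟩⟩
  have hGX : ∀ D ∈ G, D ∈ X := fun D hD => (mem_onLines.mp (hGm D hD).1).1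
  have hφ : ∀ D ∈ G, ∃ f, UsesLine g D f ∧ z ∈ f := by
    intro D hD
    obtain ⟨i, hi⟩ := h.cover D (hGX D hD) z hzX.1 (by
      rintro rfl
      obtain ⟨-, i, hi⟩ := mem_onLines.mp (hGm _ hD).1
      exact hzX.2 i hi)
    exact ⟨g D i, ⟨i, rfl⟩, hi⟩
  choose! φ hu hzφ using hφ
  set F := G.image φ with hF
  set T := (onLines X K).filter (· ∉ K' j) with hT
  have hTc : T.card = 12 := by
    have h1 : (nds (onLines X K) (K' j)).card + T.card = (onLines X K).card :=
      Finset.card_filter_add_card_filter_not _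
    have h2 := card_nds_on_add_off X K (K' j)
    have h3 := h.card_nds_off_eq_two hK hK' hne j
    have h4 := hK'.card j
    have h5 := hK.card_onLines
    omega
  have hFl : ∀ f ∈ F, IsLine f ∧ z ∈ f := by
    intro f hf
    obtain ⟨D, hD, rfl⟩ := Finset.mem_image.mp hf
    exact ⟨h.usesLine_line (hGX D hD) (hu D hD), hzφ D hD⟩
  have hzH : z ∉ onLines X K := fun hz' => by
    obtain ⟨-, i, hi⟩ := mem_onLines.mp hz'
    exact hzX.2 i hi
  have h1 : G.card = ∑ f ∈ F, (G.filter (φ · = f)).card :=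
    Finset.card_eq_sum_card_fiberwise fun D hD => Finset.mem_image_of_mem φ hD
  have h2 := sum_card_pencil_le (S := T) (fun hz' => hzH (Finset.mem_filter.mp hz').1) hFl
  have h3 : ∑ f ∈ F, 3 * (G.filter (φ · = f)).card ≤ ∑ f ∈ F, 2 * (nds T f).card := by
    refine Finset.sum_le_sum fun f hf => ?_
    obtain ⟨hfl, hzf⟩ := hFl f hf
    obtain ⟨D, hD, hDf⟩ := Finset.mem_image.mp hf
    have hDu : UsesLine g D f := hDf ▸ hu D hD
    have hfj : f ≠ K' j := by
      rintro rfl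
      exact h.not_usesLine_of_mem_on hK' (hGm D hD).2 j hDu
    have hfK : ∀ i, K i ≠ f := by
      rintro i rfl
      exact hzX.2 i hzf
    have hTf : nds T f = nds (onLines X K) f := by
      ext P
      rw [mem_nds, mem_nds, hT, Finset.mem_filter]
      refine ⟨fun hP => ⟨hP.1.1, hP.2⟩, fun hP => ⟨⟨hP.1, fun hPj => hfj ?_⟩, hP.2⟩⟩
      exact hfl.eq_of_two (hK'.line j) (by rintro rfl; exact hzH hP.1) hP.2 hzf hPj hj
    have hS : ∀ D ∈ G.filter (φ · = f), D ∈ onLines X K ∧ D ∈ onLines X K' ∧ UsesLine g D f := by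
      intro D hD
      rw [Finset.mem_filter] at hD
      exact ⟨(hGm D hD.1).1, (hGm D hD.1).2, hD.2 ▸ hu D hD.1⟩
    rw [hTf]
    by_cases hr : Meets X K f
    · have a := h.card_le_two_of_meets hK hK' hne hfl hz hzf hfK hr hS
      have b := hK.card_nds_on_eq hfl hfK hr
      omega
    · have a := h.two_le_card_nds_on hK (hGm D hD).1 hDu
      have b : ¬ 2 ≤ (G.filter (φ · = f)).card := fun hc =>
        hr (h.meets_of_two hK hc fun D hD => ⟨(hS D hD).1, (hS D hD).2.2⟩)
      omega
  rw [← Finset.mul_sum, ← Finset.mul_sum, ← h1] at h3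
  omega

end GCConf

end TwoTriples

section FourNodes

namespace GCConf

variable {X : Finset (ℝ × ℝ)} {g : ℝ × ℝ → Fin 5 → Set (ℝ × ℝ)} {K : Fin 3 → Set (ℝ × ℝ)}
  {f : Set (ℝ × ℝ)}

lemma card_users_on_le (h : GCConf X g) (hK : Triple X K) (hf : IsLine f) {z : ℝ × ℝ}
    (hz : z ∈ offLines X K) (hzf : z ∈ f) (hr : Meets X K f) {S : Finset (ℝ × ℝ)}
    (hS : ∀ D ∈ S, D ∈ onLines X K ∧ UsesLine g D f) : S.card ≤ 4 ∧ (S.card = 4 →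
      (nds (offLines X K) f).card = 2 ∧ ∀ B ∈ offLines X K, ¬ UsesLine g B f) := by
  classical
  rcases S.eq_empty_or_nonempty with rfl | ⟨D, hD⟩
  · simp
  have hSX : ∀ D ∈ S, D ∈ X := fun D hD => (mem_onLines.mp (hS D hD).1).1
  have hfK : ∀ i, K i ≠ f := by
    rintro i rfl
    exact (mem_offLines.mp hz).2 i hzf
  have h5 := h.card_le f hf
  have h1 := card_nds_on_add_off X K f
  have h2 := hK.card_nds_on_eq hf hfK hr
  have hpos : 0 < (nds (offLines X K) f).card := Finset.card_pos.mpr ⟨z, mem_nds.mpr ⟨hz, hzf⟩⟩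
  have hDu : D ∈ users X g f := mem_users.mpr ⟨hSX D hD, (hS D hD).2⟩
  have hsub : S ⊆ users X g f := fun P hP => mem_users.mpr ⟨hSX P hP, (hS P hP).2⟩
  have hle := Finset.card_le_card hsub
  by_cases hf5 : (nds X f).card = 5
  · have h4 : (users X g f).card ≤ 4 := by
      rcases h.users_five hDu hf5 with h4 | ⟨l₁, l₂, -, -, hT⟩
      · exact h4
      · exact (h.not_two_triples hK hT (hT.ne_of_meets hfK hr)).elim
    refine ⟨by omega, fun hS4 => ⟨by omega, fun B hB hu => ?_⟩⟩
    have hBS : B ∉ S := fun hBS => by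
      obtain ⟨-, i, hi⟩ := mem_onLines.mp (hS B hBS).1
      exact (mem_offLines.mp hB).2 i hi
    have hle' := Finset.card_le_card (Finset.insert_subset
      (mem_users.mpr ⟨(mem_offLines.mp hB).1, hu⟩) hsub)
    rw [Finset.card_insert_of_notMem hBS] at hle'
    omega
  · have h3 := (h.users_four hDu (by omega)).1
    exact ⟨by omega, fun _ => by omega⟩

lemma exists_not_meets (h : GCConf X g) {A : ℝ × ℝ} (hA : FourNode X g A) (hK : Triple X K) :
    ∃ s, ¬ Meets X K (g A s) := by
  classical
  by_contra! hno
  obtain ⟨-, i, hi⟩ := mem_onLines.mp (h.fourNode_mem_on hA hK)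
  choose P hPX hPi hPs using fun s => hno s i
  have hinj : Function.Injective P := by
    intro s t hst
    by_contra hne
    exact hA.disj s t hne (P s) (hPX s) (hPs s) (hst ▸ hPs t)
  have hle := Finset.card_le_card (s := Finset.univ.image P) (t := (nds X (K i)).erase A) (by
    intro Q hQ
    obtain ⟨s, -, rfl⟩ := Finset.mem_image.mp hQ
    refine Finset.mem_erase.mpr ⟨fun he => ?_, mem_nds.mpr ⟨hPX s, hPi s⟩⟩
    exact h.notMem A hA.mem s (he ▸ hPs s))
  rw [Finset.card_image_of_injective _ hinj, Finset.card_erase_of_mem (mem_nds.mpr ⟨hA.mem, hi⟩),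
    hK.card i] at hle
  simp at hle

lemma not_fourNode (h : GCConf X g) {A : ℝ × ℝ} (hA : FourNode X g A) : False := by
  classical
  obtain ⟨K, hK⟩ := h.exists_triple hA
  obtain ⟨s, hs⟩ := h.exists_not_meets hA hK
  have hAH := h.fourNode_mem_on hA hK
  have hAs : UsesLine g A (g A s) := ⟨s, rfl⟩
  have hsK : ∀ i, K i ≠ g A s := by
    intro i hi
    exact h.not_usesLine_of_mem_on hK hAH i (hi ▸ hAs)
  obtain ⟨z, hz⟩ : (nds (offLines X K) (g A s)).Nonempty := by
    have h1 := card_nds_on_add_off X K (g A s)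
    have h2 := hK.card_nds_on_le (h.line A hA.mem s) hsK
    have h3 := hA.card s
    rw [← Finset.card_pos]
    omega
  obtain ⟨hz, hzs⟩ := mem_nds.mp hz
  have hzX := mem_offLines.mp hz
  set H := onLines X K with hH
  have hHX : ∀ D ∈ H, D ∈ X := fun D hD => (mem_onLines.mp hD).1
  have hzH : z ∉ H := fun hz' => by
    obtain ⟨-, i, hi⟩ := mem_onLines.mp hz'
    exact hzX.2 i hi
  have hφ : ∀ D ∈ H, ∃ f, UsesLine g D f ∧ z ∈ f ∧ (D = A → f = g A s) := by
    intro D hD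
    by_cases hDA : D = A
    · exact ⟨g A s, ⟨s, by rw [hDA]⟩, hzs, fun _ => rfl⟩
    · obtain ⟨i, hi⟩ := h.cover D (hHX D hD) z hzX.1 (by rintro rfl; exact hzH hD)
      exact ⟨g D i, ⟨i, rfl⟩, hi, fun e => absurd e hDA⟩
  choose! φ hu hzφ hφA using hφ
  set F := H.image φ with hF
  have hsF : g A s ∈ F := Finset.mem_image.mpr ⟨A, hAH, hφA A hAH rfl⟩
  have hFl : ∀ f ∈ F, IsLine f ∧ z ∈ f := by
    intro f hf
    obtain ⟨D, hD, rfl⟩ := Finset.mem_image.mp hf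
    exact ⟨h.usesLine_line (hHX D hD) (hu D hD), hzφ D hD⟩
  have hS : ∀ f, ∀ D ∈ H.filter (φ · = f), D ∈ onLines X K ∧ UsesLine g D f := by
    intro f D hD
    rw [Finset.mem_filter] at hD
    exact ⟨hD.1, hD.2 ▸ hu D hD.1⟩
  have h1 : H.card = ∑ f ∈ F, (H.filter (φ · = f)).card :=
    Finset.card_eq_sum_card_fiberwise fun D hD => Finset.mem_image_of_mem φ hD
  have h2 := sum_card_pencil_le hzH hFl
  have hn : ∀ f ∈ F, (if Meets X K f then 3 else 2) ≤ (nds H f).card := by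
    intro f hf
    split_ifs with hr
    · exact (hK.card_nds_on_eq (hFl f hf).1
        (by rintro i rfl; exact hzX.2 i (hFl _ hf).2) hr).ge
    · obtain ⟨D, hD, rfl⟩ := Finset.mem_image.mp hf
      exact h.two_le_card_nds_on hK hD (hu D hD)
  have hfib : ∀ f ∈ F, (H.filter (φ · = f)).card ≤ (if Meets X K f then 3 else 1) +
      if (H.filter (φ · = f)).card = 4 then 1 else 0 := by
    intro f hf
    by_cases hr : Meets X K f
    · have := (h.card_users_on_le hK (hFl f hf).1 hz (hFl f hf).2 hr (hS f)).1
      rw [if_pos hr]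
      split_ifs <;> omega
    · have : ¬ 2 ≤ (H.filter (φ · = f)).card := fun hc => hr (h.meets_of_two hK hc (hS f))
      rw [if_neg hr]
      omega
  have hbad : (F.filter (fun f => (H.filter (φ · = f)).card = 4)).card ≤ 1 := by
    rw [Finset.card_le_one]
    intro f hf f' hf'
    rw [Finset.mem_filter] at hf hf'
    by_contra hne
    have key : ∀ f ∈ F, (H.filter (φ · = f)).card = 4 →
        (nds (offLines X K) f).card = 2 ∧ ∀ B ∈ offLines X K, ¬ UsesLine g B f := by
      intro f hf h4
      exact (h.card_users_on_le hK (hFl f hf).1 hz (hFl f hf).2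
        (h.meets_of_two hK (by omega) (hS f)) (hS f)).2 h4
    have a := key f hf.1 hf.2
    have a' := key f' hf'.1 hf'.2
    obtain ⟨B, hB, hu | hu⟩ := h.exists_user_of_two_lines hK (hFl f hf.1).1 (hFl f' hf'.1).1 hne
      hz (hFl f hf.1).2 (hFl f' hf'.1).2 a.1 a'.1
    · exact a.2 B hB hu
    · exact a'.2 B hB hu
  have hspos : 0 < (F.filter (fun f => ¬ Meets X K f)).card :=
    Finset.card_pos.mpr ⟨g A s, Finset.mem_filter.mpr ⟨hsF, hs⟩⟩
  have h3 := Finset.sum_le_sum hn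
  have h4 := Finset.sum_le_sum hfib
  rw [Finset.sum_add_distrib, ← Finset.card_filter] at h4
  rw [Finset.sum_ite, Finset.sum_const, Finset.sum_const, smul_eq_mul, smul_eq_mul] at h3 h4
  have h5 := hK.card_onLines
  rw [← hH] at h5
  omega

end GCConf

end FourNodes

section Main

lemma nodesOn_eq_card {X : Set (ℝ × ℝ)} (hX : X.Finite) (l : MvPolynomial (Fin 2) ℝ) :
    nodesOn X l = (nds hX.toFinset (lineSet l)).card := by
  rw [nodesOn, ← Set.ncard_coe_finset]
  congr 1
  ext P
  simp [mem_nds]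

lemma Poised.nodesOn_le {n : ℕ} {X : Set (ℝ × ℝ)} (hX : Poised (n + 1) X)
    {l : MvPolynomial (Fin 2) ℝ} (hl : IsLinePoly l) {m : ℕ}
    (hm : X.ncard < m + ((Finset.range (n + 1) ×ˢ Finset.range (n + 1)).filter
      (fun x => x.1 + x.2 ≤ n)).card) : nodesOn X l < m := by
  classical
  by_contra! hle
  rw [nodesOn_eq_card hX.1] at hle
  have hsum : (nds hX.1.toFinset (lineSet l)).card +
      (hX.1.toFinset.filter (· ∉ lineSet l)).card = hX.1.toFinset.card :=
    Finset.card_filter_add_card_filter_not _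
  rw [Set.ncard_eq_toFinset_card X hX.1] at hm
  obtain ⟨p, hp0, hp, hpz⟩ := exists_vanishing (n := n)
    (hX.1.toFinset.filter (· ∉ lineSet l)) (by omega)
  have hlp := hX.2.2 (l * p) ((totalDegree_mul _ _).trans (by rw [IsLinePoly] at hl; omega))
    fun P hP => by
      rw [ev_mul, mul_eq_zero]
      by_cases hPl : P ∈ lineSet l
      · exact Or.inl hPl
      · exact Or.inr (hpz P (Finset.mem_filter.mpr ⟨hX.1.mem_toFinset.mpr hP, hPl⟩))
  rcases mul_eq_zero.mp hlp with rfl | h0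
  · simp [IsLinePoly] at hl
  · exact hp0 h0

lemma gcConf_of_gcSet {X : Set (ℝ × ℝ)} (hX : GCSet 5 X) (hnm : NoMaximalLine 5 X)
    {M : ℝ × ℝ → Fin 5 → MvPolynomial (Fin 2) ℝ} (hM : ∀ B ∈ X, ∀ i, IsLinePoly (M B i))
    (hfund : ∀ B ∈ X, ∃ c : ℝ, IsFund 5 X B (C c * ∏ i, M B i)) :
    GCConf hX.1.1.toFinset (fun B i => lineSet (M B i)) where
  card := by rw [← Set.ncard_eq_toFinset_card X hX.1.1, hX.1.2.1]
  line B hB i := ⟨M B i, hM B (hX.1.1.mem_toFinset.mp hB) i, rfl⟩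
  notMem B hB i hi := by
    replace hi : ev (M B i) B = 0 := hi
    obtain ⟨c, -, h1, -⟩ := hfund B (hX.1.1.mem_toFinset.mp hB)
    rw [ev_mul, ev_prod, Finset.prod_eq_zero (Finset.mem_univ i) hi, mul_zero] at h1
    exact zero_ne_one h1
  cover B hB P hP hne := by
    obtain ⟨c, -, h1, h0⟩ := hfund B (hX.1.1.mem_toFinset.mp hB)
    have hP0 := h0 P (hX.1.1.mem_toFinset.mp hP) hne
    rw [ev_mul, mul_eq_zero, ev_prod, Finset.prod_eq_zero_iff] at hP0
    rcases hP0 with hc | ⟨i, -, hi⟩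
    · rw [ev_C] at hc
      rw [ev_mul, ev_C, hc, zero_mul] at h1
      exact (zero_ne_one h1).elim
    · exact ⟨i, hi⟩
  poised p hp hpX := hX.1.2.2 p hp fun P hP => hpX P (hX.1.1.mem_toFinset.mpr hP)
  card_le f hf := by
    obtain ⟨l, hl, rfl⟩ := hf
    have h6 := hnm l hl
    have h7 := hX.1.nodesOn_le hl (m := 7) (by
      rw [hX.1.2.1]
      decide)
    rw [nodesOn_eq_card hX.1.1] at h6 h7
    omega

lemma MLineSeq.disjoint_of_resCount_eq {X : Set (ℝ × ℝ)} (hX : X.Finite) {A : ℝ × ℝ}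
    {L : Fin 5 → MvPolynomial (Fin 2) ℝ} (hL : MLineSeq X A L)
    (h4 : ∀ s, resCount X L s (L s) = 4) :
    (∀ i, (nds hX.toFinset (lineSet (L i))).card = 4) ∧
      ∀ i j, i ≠ j → ∀ P ∈ X, P ∈ lineSet (L i) → P ∉ lineSet (L j) := by
  have hle : ∀ t, (X ∩ lineSet (L t)).ncard ≤ 4 := by
    intro t
    refine le_of_eq_of_le ?_ ((hL.2.2.2 0 t (Fin.zero_le t)).trans_eq (h4 0))
    rw [resCount]
    congr 1
    ext P
    simp [lineSet]
  have hsub : ∀ s, {B ∈ X | ev (L s) B = 0 ∧ ∀ i : Fin 5, i < s → ev (L i) B ≠ 0} ⊆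
      X ∩ lineSet (L s) := fun s B hB => ⟨hB.1, hB.2.1⟩
  have heq : ∀ s, {B ∈ X | ev (L s) B = 0 ∧ ∀ i : Fin 5, i < s → ev (L i) B ≠ 0} =
      X ∩ lineSet (L s) := fun s => Set.eq_of_subset_of_ncard_le (hsub s)
    ((hle s).trans_eq (h4 s).symm) (hX.inter_of_left _)
  have hlt : ∀ i j, i < j → ∀ P ∈ X, P ∈ lineSet (L j) → P ∉ lineSet (L i) := by
    intro i j hij P hP hPj
    have hPm : P ∈ X ∩ lineSet (L j) := ⟨hP, hPj⟩
    rw [← heq j] at hPm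
    exact hPm.2.2 i hij
  refine ⟨fun i => ?_, fun i j hij P hP hPi hPj => ?_⟩
  · rw [← nodesOn_eq_card, nodesOn, ← heq i]
    exact h4 i
  · rcases lt_or_gt_of_ne hij with hij | hij
    · exact hlt i j hij P hP hPj hPi
    · exact hlt j i hij P hP hPi hPj

end Main

/-- in a `GC_5` set with no maximal line, no node has m-distribution
sequence `(4,4,4,4,4)`. -/
theorem no_44444 (X : Set (ℝ × ℝ)) (hX : GCSet 5 X) (hnm : NoMaximalLine 5 X) :
    ∀ A ∈ X, ¬ HasMDSeq X A ![4, 4, 4, 4, 4] := by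
  rintro A hA ⟨L, hL, h4⟩
  have h4' : ∀ s, resCount X L s (L s) = 4 := fun s => by
    rw [h4 s]
    fin_cases s <;> rfl
  have hM : ∀ B ∈ X, ∃ M : Fin 5 → MvPolynomial (Fin 2) ℝ, (∀ i, IsLinePoly (M i)) ∧
      (∃ c : ℝ, IsFund 5 X B (C c * ∏ i, M i)) ∧ (B = A → M = L) := by
    intro B hB
    by_cases hBA : B = A
    · obtain ⟨p, hp, c, rfl⟩ := hL.2.2.1
      exact ⟨L, hL.1, ⟨c, hBA ▸ hp⟩, fun _ => rfl⟩
    · obtain ⟨p, hp, M, hM, rfl⟩ := hX.2 B hB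
      exact ⟨M, hM, ⟨1, by rwa [C_1, one_mul]⟩, fun e => absurd e hBA⟩
  choose! M hM hfund hMA using hM
  obtain ⟨hc, hd⟩ := hL.disjoint_of_resCount_eq hX.1.1 h4'
  have hMA' := hMA A hA rfl
  refine (gcConf_of_gcSet hX hnm hM hfund).not_fourNode (A := A)
    ⟨hX.1.1.mem_toFinset.mpr hA, fun i => ?_, fun i j hij P hP => ?_⟩
  · simp only [hMA']
    exact hc i
  · simp only [hMA']
    exact hd i j hij P (hX.1.1.mem_toFinset.mp hP)
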